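/- Let p > 1. (1) The Hilbert transform 𝓗(φ)(x) = (1/πi) p.v. ∫_S φ(ζ)/(ζ − x) dζ (x ∈ S) maps B_p(S) into B_p(S) and is a Banach-space automorphism of B_p(S) satisfying 𝓗 ∘ 𝓗 = I. (2) The Szegő projection 𝓢(φ)(z) = (1/2πi) ∫_S φ(ζ)/(ζ − z) dζ (z ∈ D) is a bounded linear map from B_p(S) into the p-analytic Besov space 𝓑_p(D), and E ∘ 𝓢 : B_p(S) → B_p(S) is a bounded projection onto E(𝓑_p(D)) satisfying E ∘ 𝓢 = ½(I + 𝓗), where E denotes the nontangential boundary-value operator. -/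

import Mathlib

/-!
Common definitions used to formalize the statements of
"Transmission of harmonic functions through quasicircles on compact Riemann surfaces".

We model the extended plane by working with planar representations of sphere
self-homeomorphisms (recording the preimage/image of `∞` as `Option ℂ` data,
`none` standing for `∞` itself).
-/

open Complex MeasureTheory Metric Set Filter Topology Bornology
open scoped Real ENNReal ComplexConjugate

noncomputable section

namespace WPPaper

/-! ### Basic sets and curves -/

def unitCircleSet : Set ℂ := Metric.sphere (0 : ℂ) 1

def unitDiskSet : Set ℂ := Metric.ball (0 : ℂ) 1

def extDiskSet : Set ℂ := {z : ℂ | 1 < ‖z‖}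

/-- Arc-length (angle) parametrization of the unit circle. -/
def circlePt (θ : ℝ) : ℂ := Complex.exp (θ * Complex.I)

/-- A closed Jordan curve in `ℂ`: a homeomorphic image of the unit circle. -/
def IsJordanCurve (Γ : Set ℂ) : Prop :=
  ∃ f : ℂ → ℂ, ContinuousOn f unitCircleSet ∧ InjOn f unitCircleSet ∧
    f '' unitCircleSet = Γ

/-- `A` and `B` are the two complementary subarcs of the Jordan curve `Γ`
between the points `z₁, z₂ ∈ Γ`. -/
def IsArcPair (Γ : Set ℂ) (z₁ z₂ : ℂ) (A B : Set ℂ) : Prop :=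
  A ∪ B = Γ ∧ A ∩ B = {z₁, z₂} ∧ IsClosed A ∧ IsClosed B ∧
    IsConnected A ∧ IsConnected B

/-- `Ω` is one of the two complementary (Jordan) domains of the Jordan curve `Γ`
(as a planar set; the unbounded component represents the component of
`Ĉ ∖ Γ` containing `∞` with the point `∞` removed). -/
def IsJordanComplComponent (Ω Γ : Set ℂ) : Prop :=
  IsJordanCurve Γ ∧ IsOpen Ω ∧ IsPreconnected Ω ∧ Ω ∩ Γ = ∅ ∧ frontier Ω = Γ

/-! ### Hyperbolic densities -/

/-- Hyperbolic density of the unit disk (normalized to curvature `-4`). -/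
def rhoD (z : ℂ) : ℝ := (1 - ‖z‖ ^ 2)⁻¹

/-- Hyperbolic density of the exterior disk `𝔻* = {|z| > 1} ∪ {∞}`. -/
def rhoDStar (z : ℂ) : ℝ := (‖z‖ ^ 2 - 1)⁻¹

/-- Hyperbolic (Poincaré) density of a hyperbolic planar domain `Ω`, normalized so that
`hypDensity unitDiskSet = rhoD`; defined via the extremal (covering) map from the disk. -/
def hypDensity (Ω : Set ℂ) (z : ℂ) : ℝ :=
  (sSup {r : ℝ | ∃ f : ℂ → ℂ, DifferentiableOn ℂ f unitDiskSet ∧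
    MapsTo f unitDiskSet Ω ∧ f 0 = z ∧ r = ‖deriv f 0‖})⁻¹

/-- The constant weight `1`; for `p = 2` the hyperbolic weights in the Dirichlet
integral cancel, so the `2`-Dirichlet integral is the unweighted one. -/
def constOne : ℂ → ℝ := fun _ => 1

/-! ### Harmonic functions and Dirichlet integrals -/

/-- `|∇f(z)|`. -/
def gradNorm (f : ℂ → ℂ) (z : ℂ) : ℝ :=
  Real.sqrt (‖fderiv ℝ f z 1‖ ^ 2 + ‖fderiv ℝ f z Complex.I‖ ^ 2)

/-- `|∇f(z)|` computed from a given (weak) derivative. -/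
def gradNormL (L : ℂ →L[ℝ] ℂ) : ℝ := Real.sqrt (‖L 1‖ ^ 2 + ‖L Complex.I‖ ^ 2)

/-- `f` is (complex-valued) harmonic on `Ω`: it is `C²` there and its Laplacian vanishes. -/
def IsHarmonicOn (f : ℂ → ℂ) (Ω : Set ℂ) : Prop :=
  ContDiffOn ℝ 2 f Ω ∧ ∀ z ∈ Ω,
    fderiv ℝ (fun w => fderiv ℝ f w 1) z 1 +
      fderiv ℝ (fun w => fderiv ℝ f w Complex.I) z Complex.I = 0

/-- The `p`-Dirichlet energy `∫_Ω (|∇f| ρ⁻¹)^p ρ² dxdy` with weight `ρ`. -/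
def dirichletEnergy (p : ℝ) (ρ : ℂ → ℝ) (f : ℂ → ℂ) (Ω : Set ℂ) : ℝ≥0∞ :=
  ∫⁻ z in Ω, ENNReal.ofReal ((gradNorm f z * (ρ z)⁻¹) ^ p * (ρ z) ^ 2)

/-- The `p`-Dirichlet norm `‖f‖_{D_p}` with weight `ρ`. -/
def dirichletNorm (p : ℝ) (ρ : ℂ → ℝ) (f : ℂ → ℂ) (Ω : Set ℂ) : ℝ≥0∞ :=
  dirichletEnergy p ρ f Ω ^ (1 / p)

/-- `f ∈ HD_p(Ω)`: a `p`-Dirichlet finite harmonic function on `Ω` (weight `ρ`). -/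
def MemHD (p : ℝ) (ρ : ℂ → ℝ) (f : ℂ → ℂ) (Ω : Set ℂ) : Prop :=
  IsHarmonicOn f Ω ∧ dirichletEnergy p ρ f Ω < ⊤

/-! ### Weak derivatives, Sobolev energies -/

/-- `f'` is a weak (distributional) derivative of `f` on `Ω`. -/
def HasWeakFDerivOn (f : ℂ → ℂ) (f' : ℂ → ℂ →L[ℝ] ℂ) (Ω : Set ℂ) : Prop :=
  LocallyIntegrableOn f Ω volume ∧
  (∀ v : ℂ, LocallyIntegrableOn (fun z => f' z v) Ω volume) ∧
  ∀ ψ : ℂ → ℝ, ContDiff ℝ (⊤ : ℕ∞) ψ → HasCompactSupport ψ → tsupport ψ ⊆ Ω →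
    ∀ v : ℂ, ∫ z in Ω, ψ z • f' z v = -∫ z in Ω, fderiv ℝ ψ z v • f z

/-- The derivative `f'` is locally square integrable on `Ω` (`W^{1,2}_loc`). -/
def W12locOn (f' : ℂ → ℂ →L[ℝ] ℂ) (Ω : Set ℂ) : Prop :=
  ∀ K : Set ℂ, K ⊆ Ω → IsCompact K → (∫⁻ z in K, (‖f' z‖₊ : ℝ≥0∞) ^ 2) < ⊤

/-- The weighted `p`-Sobolev (Dirichlet) energy computed from a weak derivative. -/
def sobolevEnergyW (p : ℝ) (ρ : ℂ → ℝ) (f' : ℂ → ℂ →L[ℝ] ℂ) (Ω : Set ℂ) : ℝ≥0∞ :=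
  ∫⁻ z in Ω, ENNReal.ofReal ((gradNormL (f' z) * (ρ z)⁻¹) ^ p * (ρ z) ^ 2)

/-- The function with weak derivative `g'` can be approximated, in the weighted
`p`-Dirichlet seminorm, by smooth compactly supported functions on `Ω`;
i.e. it lies in the closure of `C₀^∞(Ω)`. -/
def ApproxByTest (p : ℝ) (ρ : ℂ → ℝ) (g' : ℂ → ℂ →L[ℝ] ℂ) (Ω : Set ℂ) : Prop :=
  ∀ ε : ℝ, 0 < ε → ∃ ψ : ℂ → ℂ, ContDiff ℝ (⊤ : ℕ∞) ψ ∧ HasCompactSupport ψ ∧ tsupport ψ ⊆ Ω ∧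
    sobolevEnergyW p ρ (fun z => g' z - fderiv ℝ ψ z) Ω < ENNReal.ofReal ε

/-! ### Wirtinger derivatives and quasiconformal maps -/

def wirtingerD (L : ℂ →L[ℝ] ℂ) : ℂ := (L 1 - Complex.I * L Complex.I) / 2

def wirtingerDBar (L : ℂ →L[ℝ] ℂ) : ℂ := (L 1 + Complex.I * L Complex.I) / 2

/-- `f` is a `K`-quasiconformal homeomorphism of `Ω` onto `Ω'`:
an orientation-preserving homeomorphism in `W^{1,2}_loc` whose Beltrami coefficient
satisfies `|μ| ≤ (K-1)/(K+1)` a.e. -/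
def IsQCOn (f : ℂ → ℂ) (Ω Ω' : Set ℂ) (K : ℝ) : Prop :=
  1 ≤ K ∧ ContinuousOn f Ω ∧ BijOn f Ω Ω' ∧
  (∃ g : ℂ → ℂ, ContinuousOn g Ω' ∧ InvOn g f Ω Ω') ∧
  ∃ f' : ℂ → ℂ →L[ℝ] ℂ, HasWeakFDerivOn f f' Ω ∧ W12locOn f' Ω ∧
    ∀ᵐ z ∂volume.restrict Ω,
      ‖wirtingerDBar (f' z)‖ ≤ (K - 1) / (K + 1) * ‖wirtingerD (f' z)‖

/-- `f` is a quasiconformal homeomorphism of `Ω` onto `Ω'` with complex dilatation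
(Beltrami coefficient) `μ`. -/
def IsQCWithBeltrami (f : ℂ → ℂ) (Ω Ω' : Set ℂ) (μ : ℂ → ℂ) : Prop :=
  ContinuousOn f Ω ∧ BijOn f Ω Ω' ∧
  (∃ g : ℂ → ℂ, ContinuousOn g Ω' ∧ InvOn g f Ω Ω') ∧
  ∃ f' : ℂ → ℂ →L[ℝ] ℂ, HasWeakFDerivOn f f' Ω ∧ W12locOn f' Ω ∧
    ∀ᵐ z ∂volume.restrict Ω, wirtingerDBar (f' z) = μ z * wirtingerD (f' z)

/-- `Γ` is a `K`-quasicircle: the image of the unit circle under a `K`-quasiconformal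
self-homeomorphism of `ℂ`. -/
def IsKQuasicircle (Γ : Set ℂ) (K : ℝ) : Prop :=
  ∃ f : ℂ → ℂ, IsQCOn f univ univ K ∧ f '' unitCircleSet = Γ

def IsQuasicircle (Γ : Set ℂ) : Prop := ∃ K : ℝ, IsKQuasicircle Γ K

/-- `Γ` is a chord-arc curve: the image of the unit circle under a bi-Lipschitz
self-homeomorphism of `ℂ`. -/
def IsChordArcCurve (Γ : Set ℂ) : Prop :=
  ∃ f : ℂ → ℂ, Function.Bijective f ∧
    (∃ L : ℝ, 1 ≤ L ∧ (∀ z w : ℂ, ‖f z - f w‖ ≤ L * ‖z - w‖) ∧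
      (∀ z w : ℂ, ‖z - w‖ ≤ L * ‖f z - f w‖)) ∧
    f '' unitCircleSet = Γ

/-! ### Circle homeomorphisms and quasisymmetry -/

/-- `h` is an orientation-preserving homeomorphism of the unit circle onto itself
(encoded by a continuous strictly increasing degree-one lift). -/
def IsCircleHomeo (h : ℂ → ℂ) : Prop :=
  ∃ H : ℝ → ℝ, Continuous H ∧ StrictMono H ∧ (∀ θ, H (θ + 2 * π) = H θ + 2 * π) ∧
    ∀ θ, h (circlePt θ) = circlePt (H θ)

/-- `h` is a quasisymmetric homeomorphism of the unit circle: an orientation-preserving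
circle homeomorphism extending to a quasiconformal self-homeomorphism of the disk. -/
def IsQuasisymmetric (h : ℂ → ℂ) : Prop :=
  IsCircleHomeo h ∧
  ∃ (Hext : ℂ → ℂ) (K : ℝ), IsQCOn Hext unitDiskSet unitDiskSet K ∧
    ContinuousOn Hext (closure unitDiskSet) ∧ ∀ ζ ∈ unitCircleSet, Hext ζ = h ζ

/-- Normalization: fixing the three boundary points `1`, `i`, `-i`. -/
def FixesNormalization (f : ℂ → ℂ) : Prop :=
  f 1 = 1 ∧ f Complex.I = Complex.I ∧ f (-Complex.I) = -Complex.I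

/-! ### Besov spaces on the circle and on rectifiable curves -/

def besovEnergy (p : ℝ) (φ : ℂ → ℂ) : ℝ≥0∞ :=
  ∫⁻ x in Ioc (0 : ℝ) (2 * π), ∫⁻ y in Ioc (0 : ℝ) (2 * π),
    ENNReal.ofReal (‖φ (circlePt x) - φ (circlePt y)‖ ^ p
      / ‖circlePt x - circlePt y‖ ^ (2 : ℕ))

def besovNorm (p : ℝ) (φ : ℂ → ℂ) : ℝ≥0∞ := besovEnergy p φ ^ (1 / p)

/-- `φ ∈ B_p(𝕊)`: the homogeneous `p`-Besov space on the unit circle. -/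
def MemBesov (p : ℝ) (φ : ℂ → ℂ) : Prop :=
  IntegrableOn (fun θ : ℝ => φ (circlePt θ)) (Ioc 0 (2 * π)) volume ∧
  besovEnergy p φ < ⊤

/-- Besov energy on a rectifiable curve `Γ`, with respect to arc length
(one-dimensional Hausdorff measure). -/
def besovEnergyCurve (p : ℝ) (Γ : Set ℂ) (φ : ℂ → ℂ) : ℝ≥0∞ :=
  ∫⁻ x in Γ, ∫⁻ y in Γ,
    ENNReal.ofReal (‖φ x - φ y‖ ^ p / ‖x - y‖ ^ (2 : ℕ)) ∂μH[1] ∂μH[1]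

def besovNormCurve (p : ℝ) (Γ : Set ℂ) (φ : ℂ → ℂ) : ℝ≥0∞ :=
  besovEnergyCurve p Γ φ ^ (1 / p)

/-- `φ ∈ B_p(Γ)`: `φ ∈ L_p(Γ)` with finite Besov energy on `Γ`. -/
def MemBesovCurve (p : ℝ) (Γ : Set ℂ) (φ : ℂ → ℂ) : Prop :=
  (∫⁻ x in Γ, ENNReal.ofReal (‖φ x‖ ^ p) ∂μH[1]) < ⊤ ∧ besovEnergyCurve p Γ φ < ⊤

/-! ### Nontangential limits and Poisson integrals -/

/-- Nontangential approach region in `Ω` at the boundary point `ζ` with aperture `M`. -/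
def ntRegion (Ω : Set ℂ) (ζ : ℂ) (M : ℝ) : Set ℂ :=
  {z ∈ Ω | ‖z - ζ‖ < M * Metric.infDist z (frontier Ω)}

/-- `f` has nontangential limit `L` at the boundary point `ζ` of `Ω`. -/
def HasNTLimAt (f : ℂ → ℂ) (Ω : Set ℂ) (L : ℂ) (ζ : ℂ) : Prop :=
  ∀ M : ℝ, 1 < M → Tendsto f (𝓝[ntRegion Ω ζ M] ζ) (𝓝 L)

/-- `φ` is the nontangential boundary-value function on `Γ` of `f : Ω → ℂ`
(a.e. with respect to arc length on `Γ`). -/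
def IsNTBoundaryFun (f : ℂ → ℂ) (Ω Γ : Set ℂ) (φ : ℂ → ℂ) : Prop :=
  ∀ᵐ ζ ∂(μH[1] : Measure ℂ).restrict Γ, HasNTLimAt f Ω (φ ζ) ζ

/-- The Poisson integral on the unit disk:
`P(φ)(z) = (1/2π) ∫_𝕊 (1-|z|²)/|ζ-z|² φ(ζ) |dζ|`. -/
def poissonDisk (φ : ℂ → ℂ) (z : ℂ) : ℂ :=
  (2 * π)⁻¹ • ∫ θ in Ioc (0 : ℝ) (2 * π),
    ((1 - ‖z‖ ^ 2) / ‖circlePt θ - z‖ ^ 2) • φ (circlePt θ)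

/-- The Poisson integral on the exterior disk. -/
def poissonExt (φ : ℂ → ℂ) (z : ℂ) : ℂ :=
  (2 * π)⁻¹ • ∫ θ in Ioc (0 : ℝ) (2 * π),
    ((‖z‖ ^ 2 - 1) / ‖circlePt θ - z‖ ^ 2) • φ (circlePt θ)

/-! ### Integrable Beltrami coefficients -/

/-- `μ ∈ M_p(Ω)`: a Beltrami coefficient on `Ω` (`‖μ‖_∞ < 1`) that is `p`-integrable
with respect to the hyperbolic metric with density `ρ`. -/
def MemMp (p : ℝ) (μ : ℂ → ℂ) (Ω : Set ℂ) (ρ : ℂ → ℝ) : Prop :=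
  AEStronglyMeasurable μ (volume.restrict Ω) ∧
  (∃ k : ℝ, k < 1 ∧ ∀ᵐ z ∂volume.restrict Ω, ‖μ z‖ ≤ k) ∧
  (∫⁻ z in Ω, ENNReal.ofReal (‖μ z‖ ^ p * (ρ z) ^ 2)) < ⊤

/-! ### Self-maps of the Riemann sphere, in planar representation -/

/-- The filter of neighborhoods of `∞` in `Ĉ`, restricted to `ℂ`. -/
def cobdd : Filter ℂ := Bornology.cobounded ℂ

/-- The planar set attached to an `Option ℂ` datum (`none` stands for `∞`). -/
def optSet (o : Option ℂ) : Set ℂ := o.elim ∅ (fun a => {a})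

/-- `f : ℂ → ℂ` is the planar representation of a self-homeomorphism of the Riemann
sphere `Ĉ`, where `zP` is the preimage of `∞` and `wP` the image of `∞`
(`none` standing for `∞`). The value of `f` on its pole is irrelevant. -/
def IsSphereHomeo (f : ℂ → ℂ) (zP wP : Option ℂ) : Prop :=
  match zP, wP with
  | none, none =>
      Continuous f ∧ Function.Bijective f ∧
      (∃ g : ℂ → ℂ, Continuous g ∧ Function.LeftInverse g f ∧ Function.RightInverse g f) ∧
      Tendsto f cobdd cobdd
  | some a, some b =>
      ContinuousOn f {a}ᶜ ∧ BijOn f {a}ᶜ {b}ᶜ ∧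
      (∃ g : ℂ → ℂ, ContinuousOn g {b}ᶜ ∧ InvOn g f {a}ᶜ {b}ᶜ) ∧
      Tendsto f (𝓝[≠] a) cobdd ∧ Tendsto f cobdd (𝓝 b)
  | _, _ => False

/-- The (planar representation of the) sphere homeomorphism `f` has complex
dilatation `μ` a.e. on the planar set `A` (away from its pole `zP`). -/
def SphereBeltramiOn (f : ℂ → ℂ) (zP : Option ℂ) (μ : ℂ → ℂ) (A : Set ℂ) : Prop :=
  ∃ f' : ℂ → ℂ →L[ℝ] ℂ, HasWeakFDerivOn f f' (A \ optSet zP) ∧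
    W12locOn f' (A \ optSet zP) ∧
    ∀ᵐ z ∂volume.restrict (A \ optSet zP),
      wirtingerDBar (f' z) = μ z * wirtingerD (f' z)

/-- The sphere homeomorphism `f` is `K`-quasiconformal on the planar set `A`. -/
def SphereQCBddOn (f : ℂ → ℂ) (zP : Option ℂ) (K : ℝ) (A : Set ℂ) : Prop :=
  ∃ f' : ℂ → ℂ →L[ℝ] ℂ, HasWeakFDerivOn f f' (A \ optSet zP) ∧
    W12locOn f' (A \ optSet zP) ∧
    ∀ᵐ z ∂volume.restrict (A \ optSet zP),
      ‖wirtingerDBar (f' z)‖ ≤ (K - 1) / (K + 1) * ‖wirtingerD (f' z)‖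

/-- Planar representation of a quasiconformal self-homeomorphism of `Ĉ` fixing
`1, i, -i`, with complex dilatation `μ₁` on the unit disk and `μ₂` on the exterior disk. -/
def IsGMap (f : ℂ → ℂ) (zP wP : Option ℂ) (μ₁ μ₂ : ℂ → ℂ) : Prop :=
  IsSphereHomeo f zP wP ∧
  SphereBeltramiOn f zP μ₁ unitDiskSet ∧
  SphereBeltramiOn f zP μ₂ extDiskSet ∧
  FixesNormalization f

/-- `Γ ⊂ ℂ` is a `p`-Weil–Petersson curve: the image of the unit circle under the
normalized quasiconformal self-map `F_μ` of `Ĉ` with dilatation `μ ∈ M_p(𝔻*)` on `𝔻*`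
and `0` on `𝔻`. -/
def IsWPCurve (p : ℝ) (Γ : Set ℂ) : Prop :=
  ∃ μ : ℂ → ℂ, MemMp p μ extDiskSet rhoDStar ∧
  ∃ (f : ℂ → ℂ) (zP wP : Option ℂ), IsGMap f zP wP (fun _ => 0) μ ∧
    optSet zP ∩ unitCircleSet = ∅ ∧ f '' unitCircleSet = Γ

/-- The reflection of a Beltrami coefficient on `𝔻*` to one on `𝔻`
under `z ↦ 1/z̄`. -/
def reflectBeltrami (ν : ℂ → ℂ) : ℂ → ℂ :=
  fun z => conj (ν ((conj z)⁻¹)) * z ^ 2 / (conj z) ^ 2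

/-- `H = H^ν`: the quasiconformal self-homeomorphism of the unit disk with complex
dilatation `ν`, extended homeomorphically to the closed disk, fixing `1, i, -i`. -/
def IsNormalizedQCDisk (H : ℂ → ℂ) (ν : ℂ → ℂ) : Prop :=
  IsQCWithBeltrami H unitDiskSet unitDiskSet ν ∧
  ContinuousOn H (closure unitDiskSet) ∧
  BijOn H (closure unitDiskSet) (closure unitDiskSet) ∧
  (∃ g : ℂ → ℂ, ContinuousOn g (closure unitDiskSet) ∧
    InvOn g H (closure unitDiskSet) (closure unitDiskSet)) ∧
  FixesNormalization H

/-! ### Riemann mappings of the complementary domains of a Jordan curve -/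

/-- Normalized Riemann mapping from the unit disk onto the complementary domain `Ω`
(planar part) of the Jordan curve `Γ`, extended by Carathéodory to the boundary and
fixing `1, i, -i`; `zP` records a possible pole (when `∞ ∈ Ω` as a `Ĉ`-domain). -/
def IsDiskRiemannTo (F : ℂ → ℂ) (zP : Option ℂ) (Ω Γ : Set ℂ) : Prop :=
  DifferentiableOn ℂ F (unitDiskSet \ optSet zP) ∧
  optSet zP ⊆ unitDiskSet ∧
  ContinuousOn F (closure unitDiskSet \ optSet zP) ∧
  InjOn F (closure unitDiskSet \ optSet zP) ∧
  F '' unitCircleSet = Γ ∧ FixesNormalization F ∧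
  (match zP with
   | none => BijOn F unitDiskSet Ω
   | some a => BijOn F (unitDiskSet \ {a}) Ω ∧ Tendsto F (𝓝[≠] a) cobdd)

/-- Normalized Riemann mapping from the exterior disk `𝔻* = {|z|>1} ∪ {∞}` onto the
complementary domain `Ω` (planar part) of the Jordan curve `Γ`; `zP` records a possible
pole in `{|z|>1}` and `wP` the (finite) image of `∞`, `none` standing for `∞`. -/
def IsExtRiemannTo (F : ℂ → ℂ) (zP wP : Option ℂ) (Ω Γ : Set ℂ) : Prop :=
  DifferentiableOn ℂ F (extDiskSet \ optSet zP) ∧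
  optSet zP ⊆ extDiskSet ∧
  ContinuousOn F ((unitCircleSet ∪ extDiskSet) \ optSet zP) ∧
  InjOn F ((unitCircleSet ∪ extDiskSet) \ optSet zP) ∧
  F '' unitCircleSet = Γ ∧ FixesNormalization F ∧
  (match zP, wP with
   | none, none => BijOn F extDiskSet Ω ∧ Tendsto F cobdd cobdd
   | none, some b => b ∈ Ω ∧ BijOn F extDiskSet (Ω \ {b}) ∧ Tendsto F cobdd (𝓝 b)
   | some a, some b => b ∈ Ω ∧ BijOn F (extDiskSet \ {a}) (Ω \ {b}) ∧
       Tendsto F (𝓝[≠] a) cobdd ∧ Tendsto F cobdd (𝓝 b)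
   | some _, none => False)

/-- The transmission relation across `Γ`: `Φ₂` is obtained from `Φ₁` by the composition
`(F₂)_* ∘ P₂ ∘ C_{h_Γ} ∘ E₁ ∘ (F₁)^*`, i.e. `Φ₂ ∘ F₂ = P₂(E₁(Φ₁ ∘ F₁) ∘ h_Γ)` on the
exterior disk (away from the pole of `F₂`). -/
def TransRel (F₁ F₂ h : ℂ → ℂ) (zP : Option ℂ) (Φ₁ Φ₂ : ℂ → ℂ) : Prop :=
  ∃ φ : ℂ → ℂ,
    IsNTBoundaryFun (fun z => Φ₁ (F₁ z)) unitDiskSet unitCircleSet φ ∧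
    ∀ z ∈ extDiskSet \ optSet zP, Φ₂ (F₂ z) = poissonExt (fun ζ => φ (h ζ)) z

/-! ### Hilbert transform, Szegő projection, analytic Besov space -/

/-- Truncated Hilbert transform on the circle (for the principal value). -/
def hilbertTrunc (φ : ℂ → ℂ) (θ ε : ℝ) : ℂ :=
  (π * Complex.I)⁻¹ * ∫ t in Ioc (θ - π) (θ + π) \ Ioo (θ - ε) (θ + ε),
    φ (circlePt t) / (circlePt t - circlePt θ) * (Complex.I * circlePt t)

/-- `ψ = 𝓗(φ)` a.e. on the circle: `ψ` is the principal-value Hilbert transform of `φ`. -/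
def IsHilbertTransformOf (ψ φ : ℂ → ℂ) : Prop :=
  ∀ᵐ θ ∂volume.restrict (Ioc (0 : ℝ) (2 * π)),
    Tendsto (fun ε : ℝ => hilbertTrunc φ θ ε) (𝓝[>] (0 : ℝ)) (𝓝 (ψ (circlePt θ)))

/-- The Szegő projection (Cauchy integral) `𝓢(φ)(z) = (1/2πi) ∫_𝕊 φ(ζ)/(ζ-z) dζ`. -/
def szego (φ : ℂ → ℂ) (z : ℂ) : ℂ :=
  (2 * π * Complex.I)⁻¹ * ∫ t in Ioc (0 : ℝ) (2 * π),
    φ (circlePt t) / (circlePt t - z) * (Complex.I * circlePt t)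

/-- Energy of the `p`-analytic Besov space `𝓑_p(𝔻)`. -/
def analyticBesovEnergy (p : ℝ) (f : ℂ → ℂ) : ℝ≥0∞ :=
  ∫⁻ z in unitDiskSet, ENNReal.ofReal ((‖deriv f z‖ * (rhoD z)⁻¹) ^ p * (rhoD z) ^ 2)

def analyticBesovNorm (p : ℝ) (f : ℂ → ℂ) : ℝ≥0∞ := analyticBesovEnergy p f ^ (1 / p)

/-- `f ∈ 𝓑_p(𝔻)`: holomorphic on the unit disk with finite `p`-Besov energy. -/
def MemAnalyticBesov (p : ℝ) (f : ℂ → ℂ) : Prop :=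
  DifferentiableOn ℂ f unitDiskSet ∧ analyticBesovEnergy p f < ⊤

/-! ### The p-integrable Teichmüller space -/

/-- Distance `‖μ - ν‖_p + ‖μ - ν‖_∞` on Beltrami coefficients of the disk. -/
def mpDist (p : ℝ) (μ ν : ℂ → ℂ) : ℝ :=
  ((∫⁻ z in unitDiskSet, ENNReal.ofReal (‖μ z - ν z‖ ^ p * (rhoD z) ^ 2)) ^ (1 / p)).toReal +
  (essSup (fun z => (‖μ z - ν z‖₊ : ℝ≥0∞)) (volume.restrict unitDiskSet)).toReal

/-- The space `M_p(𝔻)` of `p`-integrable Beltrami coefficients on the disk. -/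
def MpD (p : ℝ) : Type := {μ : ℂ → ℂ // MemMp p μ unitDiskSet rhoD}

/-- The topology induced by the norm `‖·‖_p + ‖·‖_∞` on `M_p(𝔻)`. -/
instance (p : ℝ) : TopologicalSpace (MpD p) :=
  TopologicalSpace.generateFrom
    {U | ∃ (μ₀ : MpD p) (ε : ℝ), U = {μ : MpD p | mpDist p μ.1 μ₀.1 < ε}}

/-- Teichmüller equivalence: the normalized quasiconformal extensions have the same
boundary values on the circle. -/
def teichRel (p : ℝ) (μ ν : MpD p) : Prop :=
  ∃ H₁ H₂ : ℂ → ℂ, IsNormalizedQCDisk H₁ μ.1 ∧ IsNormalizedQCDisk H₂ ν.1 ∧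
    EqOn H₁ H₂ unitCircleSet

/-- The `p`-integrable Teichmüller space `T_p` with the quotient topology. -/
def TeichSpace (p : ℝ) : Type := Quot (teichRel p)

def TeichSpace.mk (p : ℝ) (μ : MpD p) : TeichSpace p := Quot.mk (teichRel p) μ

instance (p : ℝ) : TopologicalSpace (TeichSpace p) :=
  TopologicalSpace.coinduced (TeichSpace.mk p) inferInstance

/-! ### Arc-length parametrizations and inscribed polygons -/

/-- `γ` is an (L-periodic) arc-length parametrization of the rectifiable Jordan
curve `Γ` of length `L`. -/
def IsArcLengthParam (γ : ℝ → ℂ) (Γ : Set ℂ) (L : ℝ) : Prop :=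
  0 < L ∧ ENNReal.ofReal L = μH[1] Γ ∧ Continuous γ ∧ (∀ s, γ (s + L) = γ s) ∧
  γ '' Ico 0 L = Γ ∧ InjOn γ (Ico 0 L) ∧
  ∀ s t : ℝ, s ≤ t → t ≤ s + L → μH[1] (γ '' Icc s t) = ENNReal.ofReal (t - s)

/-- The length of the inscribed polygon with `2ⁿ` vertices evenly distributed with
respect to arc length, starting at `γ s₀`. -/
def inscribedPolygonLength (γ : ℝ → ℂ) (L s₀ : ℝ) (n : ℕ) : ℝ :=
  ∑ k ∈ Finset.range (2 ^ n),
    ‖γ (s₀ + (k + 1) * (L / 2 ^ n)) - γ (s₀ + k * (L / 2 ^ n))‖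

/-! ### The angle parametrization -/

lemma circlePt_add (a b : ℝ) : circlePt (a + b) = circlePt a * circlePt b := by
  simp [circlePt, add_mul, Complex.exp_add]

lemma circlePt_eq_circleMap (θ : ℝ) : circlePt θ = circleMap 0 1 θ := by
  simp [circlePt, circleMap]

lemma norm_circlePt (θ : ℝ) : ‖circlePt θ‖ = 1 := by
  simp [circlePt, Complex.norm_exp_ofReal_mul_I]

@[fun_prop]
lemma continuous_circlePt : Continuous circlePt := by
  unfold circlePt; fun_prop

@[fun_prop]
lemma measurable_circlePt : Measurable circlePt := continuous_circlePt.measurable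

lemma circlePt_periodic : Function.Periodic circlePt (2 * π) := by
  intro θ
  simp [circlePt, add_mul, Complex.exp_add]

lemma circlePt_mem (θ : ℝ) : circlePt θ ∈ unitCircleSet := by
  simp [unitCircleSet, norm_circlePt]

lemma norm_circlePt_sub (a b : ℝ) : ‖circlePt a - circlePt b‖ = ‖circlePt (a - b) - 1‖ := by
  have : circlePt a - circlePt b = circlePt b * (circlePt (a - b) - 1) := by
    rw [mul_sub, ← circlePt_add]; simp
  rw [this, norm_mul, norm_circlePt, one_mul]

lemma norm_circlePt_sub_one_le (s : ℝ) : ‖circlePt s - 1‖ ≤ |s| := by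
  have := Real.norm_exp_I_mul_ofReal_sub_one_le (x := s)
  rwa [mul_comm] at this

lemma le_norm_circlePt_sub_one {s : ℝ} (hs : |s| ≤ π) : 2 / π * |s| ≤ ‖circlePt s - 1‖ := by
  have h := Complex.norm_exp_I_mul_ofReal_sub_one s
  rw [mul_comm] at h
  have h2 : |s / 2| ≤ π / 2 := by rw [abs_div, abs_two]; linarith
  have h3 := Real.mul_abs_le_abs_sin h2
  rw [abs_div, abs_two] at h3
  change _ ≤ ‖Complex.exp _ - 1‖
  rw [h, norm_mul, Real.norm_eq_abs, Real.norm_eq_abs, abs_two]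
  calc 2 / π * |s| = 2 * (2 / π * (|s| / 2)) := by ring
    _ ≤ _ := by gcongr

lemma exists_mem_circlePt_eq {ζ : ℂ} (hζ : ζ ∈ unitCircleSet) (a : ℝ) :
    ∃ θ ∈ Ioc a (a + 2 * π), circlePt θ = ζ := by
  have h1 : ‖ζ‖ = 1 := by simpa [unitCircleSet] using hζ
  obtain ⟨y, hy, hy'⟩ := circlePt_periodic.exists_mem_Ioc Real.two_pi_pos (Complex.arg ζ) a
  refine ⟨y, hy, hy'.symm.trans ?_⟩
  have := Complex.norm_mul_exp_arg_mul_I ζ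
  rw [h1] at this
  simpa [circlePt] using this

/-! ### Periodic functions and null sets -/

lemma lintegral_Ioc_periodic {F : ℝ → ℝ≥0∞} (hF : Function.Periodic F (2 * π)) (a b : ℝ) :
    ∫⁻ x in Ioc a (a + 2 * π), F x = ∫⁻ x in Ioc b (b + 2 * π), F x := by
  refine (isAddFundamentalDomain_Ioc Real.two_pi_pos a).setLIntegral_eq
    (isAddFundamentalDomain_Ioc Real.two_pi_pos b) F ?_
  rintro ⟨g, n, rfl⟩ x
  have := hF.zsmul n x
  simpa [AddSubgroup.vadd_def, add_comm] using this

lemma lintegral_Ioc_shift {F : ℝ → ℝ≥0∞} (hF : Function.Periodic F (2 * π)) (a b c : ℝ) :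
    ∫⁻ x in Ioc a (a + 2 * π), F (x + c) = ∫⁻ x in Ioc b (b + 2 * π), F x := by
  rw [← lintegral_Ioc_periodic hF (a + c) b]
  have := (measurePreserving_add_right (volume : Measure ℝ) c).setLIntegral_comp_preimage_emb
    (measurableEmbedding_addRight c) F (Ioc (a + c) (a + c + 2 * π))
  rw [← this]
  congr 2
  ext x
  simp only [mem_Ioc, mem_preimage]
  constructor <;> rintro ⟨h1, h2⟩ <;> constructor <;> linarith

lemma lintegral_Ioc_circlePt_shift (F : ℂ → ℝ≥0∞) (a b c : ℝ) :
    ∫⁻ x in Ioc a (a + 2 * π), F (circlePt (x + c)) =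
      ∫⁻ x in Ioc b (b + 2 * π), F (circlePt x) :=
  lintegral_Ioc_shift (F := fun x => F (circlePt x)) (circlePt_periodic.comp F) a b c

/-- A property of almost every angle in `(0, 2π]`. -/
def CircleAE (P : ℂ → Prop) : Prop :=
  ∀ᵐ θ ∂volume.restrict (Ioc (0 : ℝ) (2 * π)), P (circlePt θ)

lemma CircleAE.ae {P : ℂ → Prop} (h : CircleAE P) : ∀ᵐ θ : ℝ, P (circlePt θ) := by
  rw [CircleAE, ae_iff, Measure.restrict_apply' measurableSet_Ioc] at h
  rw [ae_iff]
  have hd := isAddFundamentalDomain_Ioc Real.two_pi_pos 0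
  rw [zero_add] at hd
  refine hd.measure_zero_of_invariant _ ?_ h
  rintro ⟨g, n, rfl⟩
  ext x
  have := circlePt_periodic.sub_zsmul_eq n (x := x)
  rw [mem_vadd_set_iff_neg_vadd_mem]
  simp only [mem_ofPred_eq, AddSubgroup.vadd_def, vadd_eq_add]
  simp only [AddSubgroup.coe_neg, neg_add_eq_sub]
  rw [this]

/-! ### Power integrals -/

lemma lintegral_Ioc_rpow {α σ : ℝ} (hα : -1 < α) (hσ : 0 < σ) :
    ∫⁻ t in Ioc 0 σ, ENNReal.ofReal (t ^ α) = ENNReal.ofReal (σ ^ (α + 1) / (α + 1)) := by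
  have hi : IntervalIntegrable (fun t : ℝ => t ^ α) volume 0 σ :=
    intervalIntegral.intervalIntegrable_rpow' hα
  rw [← ofReal_integral_eq_lintegral_ofReal]
  · rw [← intervalIntegral.integral_of_le hσ.le, integral_rpow (Or.inl hα),
      Real.zero_rpow (by linarith), sub_zero]
  · exact (intervalIntegrable_iff_integrableOn_Ioc_of_le hσ.le).1 hi
  · filter_upwards [ae_restrict_mem measurableSet_Ioc] with t ht
    exact Real.rpow_nonneg ht.1.le _

lemma lintegral_Ioi_rpow {α σ : ℝ} (hα : α < -1) (hσ : 0 < σ) :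
    ∫⁻ t in Ioi σ, ENNReal.ofReal (t ^ α) = ENNReal.ofReal (-σ ^ (α + 1) / (α + 1)) := by
  rw [← ofReal_integral_eq_lintegral_ofReal]
  · rw [integral_Ioi_rpow_of_lt hα hσ]
  · exact integrableOn_Ioi_rpow_of_lt hα hσ
  · filter_upwards [ae_restrict_mem measurableSet_Ioi] with t ht
    exact Real.rpow_nonneg (hσ.trans ht).le _

lemma lintegral_rpow_mul_max_rpow_le {α β : ℝ} (h1 : -1 < α) (h2 : α - β < -1) :
    ∃ C : ℝ, 0 < C ∧ ∀ σ : ℝ, 0 < σ →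
      ∫⁻ t in Ioi (0 : ℝ), ENNReal.ofReal (t ^ α * (max t σ) ^ (-β)) ≤
        ENNReal.ofReal (C * σ ^ (α + 1 - β)) := by
  have hA : 0 < α + 1 := by linarith
  have hB : α - β + 1 < 0 := by linarith
  refine ⟨1 / (α + 1) + 1 / (-(α - β + 1)), ?_, fun σ hσ => ?_⟩
  · have : 0 < -(α - β + 1) := by linarith
    positivity
  have hU : Ioi (0 : ℝ) = Ioc 0 σ ∪ Ioi σ := (Ioc_union_Ioi_eq_Ioi hσ.le).symm
  rw [hU]
  refine (lintegral_union_le _ _ _).trans ?_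
  have e1 : ∫⁻ t in Ioc 0 σ, ENNReal.ofReal (t ^ α * (max t σ) ^ (-β)) =
      ENNReal.ofReal (1 / (α + 1) * σ ^ (α + 1 - β)) := by
    have : ∫⁻ t in Ioc 0 σ, ENNReal.ofReal (t ^ α * (max t σ) ^ (-β)) =
        ∫⁻ t in Ioc 0 σ, ENNReal.ofReal (t ^ α) * ENNReal.ofReal (σ ^ (-β)) := by
      refine setLIntegral_congr_fun measurableSet_Ioc fun t ht => ?_
      rw [max_eq_right ht.2, ENNReal.ofReal_mul (Real.rpow_nonneg ht.1.le _)]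
    rw [this, lintegral_mul_const' _ _ ENNReal.ofReal_ne_top, lintegral_Ioc_rpow h1 hσ,
      ← ENNReal.ofReal_mul (by positivity)]
    congr 1
    rw [show α + 1 - β = (α + 1) + -β by ring, Real.rpow_add hσ (α + 1)]
    ring
  have e2 : ∫⁻ t in Ioi σ, ENNReal.ofReal (t ^ α * (max t σ) ^ (-β)) =
      ENNReal.ofReal (1 / (-(α - β + 1)) * σ ^ (α + 1 - β)) := by
    have : ∫⁻ t in Ioi σ, ENNReal.ofReal (t ^ α * (max t σ) ^ (-β)) =
        ∫⁻ t in Ioi σ, ENNReal.ofReal (t ^ (α - β)) := by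
      refine setLIntegral_congr_fun measurableSet_Ioi fun t ht => ?_
      have ht' : σ < t := ht
      rw [max_eq_left ht'.le, ← Real.rpow_add (hσ.trans ht'), sub_eq_add_neg]
    rw [this, lintegral_Ioi_rpow h2 hσ]
    congr 1
    rw [show α - β + 1 = α + 1 - β by ring, neg_div, div_eq_mul_inv, one_div, inv_neg]
    ring
  rw [e1, e2, ← ENNReal.ofReal_add, add_mul]
  · positivity
  · have : 0 < -(α - β + 1) := by linarith
    positivity

/-! ### Hölder's inequality with a weight -/

lemma lintegral_rpow_le_weight {X : Type*} [MeasurableSpace X] {μ : Measure X} {p : ℝ}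
    (hp : 1 < p) {G W : X → ℝ} (hG : AEMeasurable G μ) (hW : AEMeasurable W μ)
    (hG0 : ∀ᵐ x ∂μ, 0 ≤ G x) (hW0 : ∀ᵐ x ∂μ, 0 < W x) (c : ℝ) :
    (∫⁻ x, ENNReal.ofReal (G x) ∂μ) ^ p ≤
      (∫⁻ x, ENNReal.ofReal (G x ^ p * W x ^ c) ∂μ) *
        (∫⁻ x, ENNReal.ofReal (W x ^ (-c / (p - 1))) ∂μ) ^ (p - 1) := by
  have hp0 : 0 < p := by linarith
  have hp1 : 0 < p - 1 := by linarith
  have hq : p.HolderConjugate (p / (p - 1)) := Real.HolderConjugate.conjExponent hp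
  have key := ENNReal.lintegral_mul_le_Lp_mul_Lq μ hq
    (f := fun x => ENNReal.ofReal (G x * W x ^ (c / p)))
    (g := fun x => ENNReal.ofReal (W x ^ (-c / p)))
    (hG.mul (hW.pow_const _)).ennreal_ofReal (hW.pow_const _).ennreal_ofReal
  have e0 : ∫⁻ x, ENNReal.ofReal (G x) ∂μ = ∫⁻ x,
      ((fun x => ENNReal.ofReal (G x * W x ^ (c / p))) *
        (fun x => ENNReal.ofReal (W x ^ (-c / p)))) x ∂μ := by
    refine lintegral_congr_ae ?_
    filter_upwards [hG0, hW0] with x h1 h2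
    simp only [Pi.mul_apply]
    rw [← ENNReal.ofReal_mul (by positivity), mul_assoc, ← Real.rpow_add h2]
    simp [neg_div]
  have e1 : ∫⁻ x, (ENNReal.ofReal (G x * W x ^ (c / p))) ^ p ∂μ =
      ∫⁻ x, ENNReal.ofReal (G x ^ p * W x ^ c) ∂μ := by
    refine lintegral_congr_ae ?_
    filter_upwards [hG0, hW0] with x h1 h2
    rw [ENNReal.ofReal_rpow_of_nonneg (by positivity) hp0.le,
      Real.mul_rpow h1 (by positivity), ← Real.rpow_mul h2.le, div_mul_cancel₀ _ hp0.ne']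
  have e2 : ∫⁻ x, (ENNReal.ofReal (W x ^ (-c / p))) ^ (p / (p - 1)) ∂μ =
      ∫⁻ x, ENNReal.ofReal (W x ^ (-c / (p - 1))) ∂μ := by
    refine lintegral_congr_ae ?_
    filter_upwards [hW0] with x h2
    rw [ENNReal.ofReal_rpow_of_nonneg (by positivity) (by positivity), ← Real.rpow_mul h2.le]
    congr 2
    field_simp
  rw [e0]
  rw [e1, e2] at key
  refine (ENNReal.rpow_le_rpow key hp0.le).trans_eq ?_
  rw [ENNReal.mul_rpow_of_nonneg _ _ hp0.le, ← ENNReal.rpow_mul, ← ENNReal.rpow_mul]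
  congr 2
  · rw [one_div_mul_cancel hp0.ne', ENNReal.rpow_one]
  · field_simp

/-! ### Basic facts about the circle Besov space -/

lemma lintegral_Ioc_abs (F : ℝ → ℝ≥0∞) :
    ∫⁻ s in Ioc (-π) π, F |s| = 2 * ∫⁻ s in Ioc 0 π, F s := by
  have hU : Ioc (-π) π = Ioc (-π) 0 ∪ Ioc 0 π :=
    (Ioc_union_Ioc_eq_Ioc (by linarith [Real.pi_pos]) Real.pi_pos.le).symm
  have e2 : ∫⁻ s in Ioc 0 π, F |s| = ∫⁻ s in Ioc 0 π, F s :=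
    setLIntegral_congr_fun measurableSet_Ioc fun t ht => by rw [abs_of_pos ht.1]
  have e1 : ∫⁻ s in Ioc (-π) 0, F |s| = ∫⁻ s in Ioc 0 π, F s := by
    have h := (Measure.measurePreserving_neg (volume : Measure ℝ)).setLIntegral_comp_preimage_emb
      (MeasurableEquiv.neg ℝ).measurableEmbedding F (Ico 0 π)
    rw [setLIntegral_congr (Ico_ae_eq_Ioc (a := (0 : ℝ)) (b := π))] at h
    rw [← h]
    have hp : (fun x : ℝ => -x) ⁻¹' Ico 0 π = Ioc (-π) 0 := by
      ext x; simp only [mem_preimage, mem_Ico, mem_Ioc]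
      constructor <;> rintro ⟨h1, h2⟩ <;> constructor <;> linarith
    have hp' : (Neg.neg : ℝ → ℝ) ⁻¹' Ico 0 π = Ioc (-π) 0 := hp
    rw [hp']
    exact setLIntegral_congr_fun measurableSet_Ioc fun t ht => by rw [abs_of_nonpos ht.2]
  rw [hU, lintegral_union measurableSet_Ioc, e1, e2, two_mul]
  rw [Set.disjoint_left]
  rintro x ⟨_, h1⟩ ⟨h2, _⟩
  linarith

lemma lintegral_Ioc_circlePt_add (F : ℂ → ℝ≥0∞) (x : ℝ) :
    ∫⁻ y in Ioc 0 (2 * π), F (circlePt y) = ∫⁻ s in Ioc (-π) π, F (circlePt (x + s)) := by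
  have h := lintegral_Ioc_circlePt_shift F (-π) 0 x
  rw [show -π + 2 * π = π by ring, zero_add] at h
  rw [← h]
  simp_rw [add_comm x]

lemma besovEnergy_eq (p : ℝ) (φ : ℂ → ℂ) :
    besovEnergy p φ = ∫⁻ x in Ioc (0 : ℝ) (2 * π), ∫⁻ s in Ioc (-π) π,
      ENNReal.ofReal (‖φ (circlePt (x + s)) - φ (circlePt x)‖ ^ p / ‖circlePt s - 1‖ ^ (2 : ℕ)) := by
  unfold besovEnergy
  refine lintegral_congr fun x => ?_
  rw [lintegral_Ioc_circlePt_add (fun w => ENNReal.ofReal (‖φ (circlePt x) - φ w‖ ^ p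
      / ‖circlePt x - w‖ ^ (2 : ℕ))) x]
  refine lintegral_congr fun s => ?_
  rw [norm_sub_rev, norm_sub_rev (circlePt x), norm_circlePt_sub]
  simp

lemma besovEnergy_congr (p : ℝ) {φ ψ : ℂ → ℂ} (h : CircleAE fun ζ => φ ζ = ψ ζ) :
    besovEnergy p φ = besovEnergy p ψ := by
  unfold besovEnergy
  refine lintegral_congr_ae ?_
  filter_upwards [h] with x hx
  refine lintegral_congr_ae ?_
  filter_upwards [h] with y hy
  rw [hx, hy]

lemma memBesov_congr {p : ℝ} {φ ψ : ℂ → ℂ} (h : CircleAE fun ζ => φ ζ = ψ ζ) (hφ : MemBesov p φ) :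
    MemBesov p ψ :=
  ⟨hφ.1.congr h, besovEnergy_congr p h ▸ hφ.2⟩

lemma CircleAE.symm {φ ψ : ℂ → ℂ} (h : CircleAE fun ζ => φ ζ = ψ ζ) :
    CircleAE fun ζ => ψ ζ = φ ζ := by
  filter_upwards [h] with θ hθ using hθ.symm

lemma exists_measurable_circleAE_eq {φ : ℂ → ℂ}
    (h : AEStronglyMeasurable (fun θ : ℝ => φ (circlePt θ))
      (volume.restrict (Ioc (0 : ℝ) (2 * π)))) :
    ∃ φ' : ℂ → ℂ, Measurable φ' ∧ CircleAE fun ζ => φ' ζ = φ ζ := by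
  classical
  set u := h.mk _
  have hu : Measurable u := h.stronglyMeasurable_mk.measurable
  let A : ℂ → ℝ := fun z => if z.arg ≤ 0 then z.arg + 2 * π else z.arg
  have hA : Measurable A :=
    Measurable.ite (measurableSet_le Complex.measurable_arg measurable_const)
      (Complex.measurable_arg.add_const _) Complex.measurable_arg
  have hAc : ∀ θ ∈ Ioc (0 : ℝ) (2 * π), A (circlePt θ) = θ := by
    intro θ hθ
    by_cases h1 : θ ≤ π
    · have : (circlePt θ).arg = θ := by
        rw [circlePt, Complex.arg_exp_mul_I]
        exact (toIocMod_eq_self _).2 ⟨by linarith [hθ.1, Real.pi_pos], by linarith⟩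
      simp only [A, this, if_neg (not_le.2 hθ.1)]
    · have : (circlePt θ).arg = θ - 2 * π := by
        rw [← circlePt_periodic.sub_eq, circlePt, Complex.arg_exp_mul_I]
        exact (toIocMod_eq_self _).2 ⟨by linarith [not_le.1 h1], by linarith [hθ.2, Real.pi_pos]⟩
      have h3 : θ - 2 * π ≤ 0 := by linarith [hθ.2]
      simp only [A, this, if_pos h3]
      ring
  refine ⟨fun z => u (A z), hu.comp hA, ?_⟩
  unfold CircleAE
  filter_upwards [h.ae_eq_mk, ae_restrict_mem measurableSet_Ioc] with θ h1 h2
  rw [hAc θ h2]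
  exact h1.symm

lemma integrableOn_Ioc_circlePt {E : Type*} [NormedAddCommGroup E] {F : ℂ → E}
    (h : IntegrableOn (fun θ : ℝ => F (circlePt θ)) (Ioc 0 (2 * π))) {a b : ℝ} (hab : a ≤ b) :
    IntegrableOn (fun θ : ℝ => F (circlePt θ)) (Ioc a b) := by
  rw [← intervalIntegrable_iff_integrableOn_Ioc_of_le hab]
  refine (circlePt_periodic.comp F).intervalIntegrable₀ (by positivity) ?_ a b
  rwa [intervalIntegrable_iff_integrableOn_Ioc_of_le (by positivity)]

lemma setIntegral_Ioc_circlePt (F : ℂ → ℂ) (a b : ℝ) :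
    ∫ θ in Ioc a (a + 2 * π), F (circlePt θ) = ∫ θ in Ioc b (b + 2 * π), F (circlePt θ) := by
  have h := (circlePt_periodic.comp F).intervalIntegral_add_eq a b
  rwa [intervalIntegral.integral_of_le (by linarith [Real.pi_pos]),
    intervalIntegral.integral_of_le (by linarith [Real.pi_pos])] at h

/-- The difference quotient of `φ` based at `ζ` is absolutely integrable along the circle. -/
def DiniAt (φ : ℂ → ℂ) (ζ : ℂ) : Prop :=
  IntegrableOn (fun t : ℝ => (φ (circlePt t) - φ ζ) / (circlePt t - ζ)) (Ioc 0 (2 * π))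

lemma pos_norm_circlePt_sub_one {s : ℝ} (hs : s ∈ Ioc (-π) π) (h0 : s ≠ 0) :
    0 < ‖circlePt s - 1‖ := by
  refine lt_of_lt_of_le ?_ (le_norm_circlePt_sub_one (abs_le.2 ⟨hs.1.le, hs.2⟩))
  have := Real.pi_pos
  have := abs_pos.2 h0
  positivity

lemma lintegral_div_norm_lt_top {p : ℝ} (hp : 1 < p) {g : ℝ → ℝ} (hg : Measurable g)
    (hg0 : ∀ s, 0 ≤ g s)
    (h : ∫⁻ s in Ioc (-π) π, ENNReal.ofReal (g s ^ p / ‖circlePt s - 1‖ ^ (2 : ℕ)) < ⊤) :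
    ∫⁻ s in Ioc (-π) π, ENNReal.ofReal (g s / ‖circlePt s - 1‖) < ⊤ := by
  have hp0 : 0 < p := by linarith
  have hp1 : 0 < p - 1 := by linarith
  have hne : ∀ᵐ s ∂(volume.restrict (Ioc (-π) π)), s ≠ 0 :=
    ae_restrict_of_ae (Measure.ae_ne volume 0)
  have key := lintegral_rpow_le_weight (μ := volume.restrict (Ioc (-π) π)) hp
    (G := fun s => g s / ‖circlePt s - 1‖) (W := fun s => |s|)
    (by fun_prop) (by fun_prop)
    (Eventually.of_forall fun s => div_nonneg (hg0 s) (norm_nonneg _))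
    (by filter_upwards [hne] with s hs using abs_pos.2 hs) (p - 2)
  have hfin : (∫⁻ s in Ioc (-π) π, ENNReal.ofReal (g s / ‖circlePt s - 1‖)) ^ p < ⊤ := by
    refine lt_of_le_of_lt key (ENNReal.mul_lt_top ?_ ?_)
    · have hle : ∫⁻ s in Ioc (-π) π, ENNReal.ofReal ((g s / ‖circlePt s - 1‖) ^ p * |s| ^ (p - 2))
          ≤ ∫⁻ s in Ioc (-π) π, ENNReal.ofReal ((π / 2) ^ p) *
            ENNReal.ofReal (g s ^ p / ‖circlePt s - 1‖ ^ (2 : ℕ)) := by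
        refine lintegral_mono_ae ?_
        filter_upwards [hne, ae_restrict_mem measurableSet_Ioc] with s hs hsm
        have hd := pos_norm_circlePt_sub_one hsm hs
        have hs' := abs_pos.2 hs
        have hpi := Real.pi_pos
        have h1 := le_norm_circlePt_sub_one (abs_le.2 ⟨hsm.1.le, hsm.2⟩)
        have h2 := norm_circlePt_sub_one_le s
        rw [← ENNReal.ofReal_mul (by positivity)]
        refine ENNReal.ofReal_le_ofReal ?_
        set d := ‖circlePt s - 1‖
        have h3 : g s / d ≤ (π / 2) * (g s / |s|) := by
          rw [div_le_iff₀ hd]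
          calc g s = (π / 2 * (g s / |s|)) * (2 / π * |s|) := by field_simp
            _ ≤ _ := by
              refine mul_le_mul_of_nonneg_left h1 ?_
              have := hg0 s
              positivity
        calc (g s / d) ^ p * |s| ^ (p - 2)
            ≤ ((π / 2) * (g s / |s|)) ^ p * |s| ^ (p - 2) := by
              gcongr
              exact div_nonneg (hg0 s) hd.le
          _ = (π / 2) ^ p * (g s ^ p / |s| ^ (2 : ℕ)) := by
              have := hg0 s
              rw [Real.mul_rpow (by positivity) (by positivity),
                Real.div_rpow this hs'.le, Real.rpow_sub hs',
                ← Real.rpow_natCast]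
              field_simp
              simp
          _ ≤ _ := by
              have := hg0 s
              gcongr
      refine lt_of_le_of_lt hle ?_
      rw [lintegral_const_mul' _ _ ENNReal.ofReal_ne_top]
      exact ENNReal.mul_lt_top ENNReal.ofReal_lt_top h
    · refine ENNReal.rpow_lt_top_of_nonneg hp1.le (ne_of_lt ?_)
      rw [lintegral_Ioc_abs (fun s => ENNReal.ofReal (s ^ (-(p - 2) / (p - 1)))),
        lintegral_Ioc_rpow _ Real.pi_pos]
      · exact ENNReal.mul_lt_top (by simp) ENNReal.ofReal_lt_top
      · rw [lt_div_iff₀ hp1]; linarith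
  by_contra hcon
  rw [not_lt, top_le_iff] at hcon
  rw [hcon, ENNReal.top_rpow_of_pos hp0] at hfin
  exact lt_irrefl _ hfin

lemma diniAt_of_memBesov {p : ℝ} (hp : 1 < p) {φ : ℂ → ℂ} (hm : Measurable φ)
    (hφ : besovEnergy p φ < ⊤) : CircleAE (DiniAt φ) := by
  rw [besovEnergy_eq] at hφ
  have hmeas : Measurable fun x : ℝ => ∫⁻ s in Ioc (-π) π,
      ENNReal.ofReal (‖φ (circlePt (x + s)) - φ (circlePt x)‖ ^ p
        / ‖circlePt s - 1‖ ^ (2 : ℕ)) := by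
    refine Measurable.lintegral_prod_right' (f := fun q : ℝ × ℝ =>
      ENNReal.ofReal (‖φ (circlePt (q.1 + q.2)) - φ (circlePt q.1)‖ ^ p
        / ‖circlePt q.2 - 1‖ ^ (2 : ℕ))) ?_
    fun_prop
  unfold CircleAE
  filter_upwards [ae_lt_top hmeas hφ.ne] with θ hθ
  have h1 := lintegral_div_norm_lt_top hp
    (g := fun s => ‖φ (circlePt (θ + s)) - φ (circlePt θ)‖) (by fun_prop)
    (fun s => norm_nonneg _) hθ
  refine ⟨Measurable.aestronglyMeasurable (by fun_prop), ?_⟩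
  rw [hasFiniteIntegral_iff_norm,
    lintegral_Ioc_circlePt_add (fun w => ENNReal.ofReal ‖(φ w - φ (circlePt θ)) /
      (w - circlePt θ)‖) θ]
  refine lt_of_eq_of_lt (lintegral_congr fun s => ?_) h1
  rw [norm_div, norm_circlePt_sub]
  simp

lemma DiniAt.congr {φ ψ : ℂ → ℂ} (h : CircleAE fun ζ => φ ζ = ψ ζ) {ζ : ℂ} (hζ : φ ζ = ψ ζ)
    (hφ : DiniAt φ ζ) : DiniAt ψ ζ := by
  refine IntegrableOn.congr_fun_ae hφ ?_
  filter_upwards [h] with t ht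
  rw [ht, hζ]

lemma MemBesov.diniAt {p : ℝ} (hp : 1 < p) {φ : ℂ → ℂ} (hφ : MemBesov p φ) :
    CircleAE (DiniAt φ) := by
  obtain ⟨φ', hm, he⟩ := exists_measurable_circleAE_eq hφ.1.aestronglyMeasurable
  have h := diniAt_of_memBesov hp hm ((besovEnergy_congr p he).trans_lt hφ.2)
  unfold CircleAE at h ⊢
  filter_upwards [h, he] with θ h1 h2
  exact h1.congr he h2

/-! ### The Hilbert transform and the boundary values of the Szegő projection -/

/-- The Hilbert transform written as an absolutely convergent integral. -/
def hilb (φ : ℂ → ℂ) (ζ : ℂ) : ℂ :=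
  φ ζ + (π * Complex.I)⁻¹ * ∫ t in Ioc (0 : ℝ) (2 * π),
    (φ (circlePt t) - φ ζ) / (circlePt t - ζ) * (Complex.I * circlePt t)

lemma circlePt_add_ne {θ s : ℝ} (hs : s ∈ Ioc (-π) π) (h0 : s ≠ 0) :
    circlePt (θ + s) - circlePt θ ≠ 0 := by
  rw [← norm_pos_iff, norm_circlePt_sub, add_sub_cancel_left]
  exact pos_norm_circlePt_sub_one hs h0

lemma cauchyKernel_add_reflect {θ s : ℝ} (hs : s ∈ Ioo 0 π) :
    Complex.I * circlePt (θ - s) / (circlePt (θ - s) - circlePt θ) +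
      Complex.I * circlePt (θ + s) / (circlePt (θ + s) - circlePt θ) = Complex.I := by
  have h1 := circlePt_add_ne (θ := θ) (s := s) ⟨by linarith [hs.1, Real.pi_pos], hs.2.le⟩ hs.1.ne'
  have h2 := circlePt_add_ne (θ := θ) (s := -s) ⟨by linarith [hs.2], by linarith [hs.1, Real.pi_pos]⟩
    (by linarith [hs.1])
  rw [← sub_eq_add_neg] at h2
  have h3 : circlePt (θ - s) * circlePt (θ + s) = circlePt θ * circlePt θ := by
    rw [← circlePt_add, ← circlePt_add]; ring_nf
  rw [div_add_div _ _ h2 h1, div_eq_iff (mul_ne_zero h2 h1)]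
  linear_combination Complex.I * h3

lemma continuousOn_cauchyKernel (θ : ℝ) :
    ContinuousOn (fun t => Complex.I * circlePt t / (circlePt t - circlePt θ))
      {t | circlePt t - circlePt θ ≠ 0} :=
  ContinuousOn.div (by fun_prop) (by fun_prop) fun _ ht => ht

lemma Ioc_diff_Ioo_eq {θ ε : ℝ} (h0 : 0 < ε) (h1 : ε < π) :
    Ioc (θ - π) (θ + π) \ Ioo (θ - ε) (θ + ε) =
      Ioc (θ - π) (θ - ε) ∪ Icc (θ + ε) (θ + π) := by
  ext t
  simp only [Set.mem_sdiff, mem_Ioc, mem_Ioo, mem_union, mem_Icc, not_and, not_lt]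
  constructor
  · rintro ⟨⟨h2, h3⟩, h4⟩
    by_cases h5 : θ - ε < t
    · exact Or.inr ⟨h4 h5, h3⟩
    · exact Or.inl ⟨h2, not_lt.1 h5⟩
  · rintro (⟨h2, h3⟩ | ⟨h2, h3⟩)
    · exact ⟨⟨h2, by linarith⟩, fun h => by linarith⟩
    · exact ⟨⟨by linarith, h3⟩, fun _ => h2⟩

lemma integral_cauchyKernel_trunc {θ ε : ℝ} (h0 : 0 < ε) (h1 : ε < π) :
    IntegrableOn (fun t => Complex.I * circlePt t / (circlePt t - circlePt θ))
        (Ioc (θ - π) (θ + π) \ Ioo (θ - ε) (θ + ε)) ∧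
      ∫ t in Ioc (θ - π) (θ + π) \ Ioo (θ - ε) (θ + ε),
        Complex.I * circlePt t / (circlePt t - circlePt θ) = (π - ε) * Complex.I := by
  set F : ℝ → ℂ := fun t => Complex.I * circlePt t / (circlePt t - circlePt θ) with hF
  have hne : ∀ s ∈ Icc ε π, circlePt (θ + s) - circlePt θ ≠ 0 := fun s hs =>
    circlePt_add_ne ⟨by linarith [hs.1], hs.2⟩ (by linarith [hs.1])
  have hne' : ∀ s ∈ Icc ε π, circlePt (θ - s) - circlePt θ ≠ 0 := fun s hs => by
    rw [← norm_pos_iff, norm_circlePt_sub, show θ - s - θ = θ - (θ + s) by ring,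
      ← norm_circlePt_sub, norm_sub_rev, norm_pos_iff]
    exact hne s hs
  have c1 : ContinuousOn F (Icc (θ + ε) (θ + π)) := by
    refine (continuousOn_cauchyKernel θ).mono fun t ht => ?_
    have := hne (t - θ) ⟨by linarith [ht.1], by linarith [ht.2]⟩
    rwa [add_sub_cancel] at this
  have c2 : ContinuousOn F (Icc (θ - π) (θ - ε)) := by
    refine (continuousOn_cauchyKernel θ).mono fun t ht => ?_
    have := hne' (θ - t) ⟨by linarith [ht.2], by linarith [ht.1]⟩
    rwa [sub_sub_cancel] at this
  have i1 : IntegrableOn F (Icc (θ + ε) (θ + π)) := c1.integrableOn_Icc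
  have i2 : IntegrableOn F (Ioc (θ - π) (θ - ε)) := c2.integrableOn_Icc.mono_set Ioc_subset_Icc_self
  rw [Ioc_diff_Ioo_eq h0 h1]
  refine ⟨i2.union i1, ?_⟩
  rw [setIntegral_union _ measurableSet_Icc i2 i1, integral_Icc_eq_integral_Ioc,
    ← intervalIntegral.integral_of_le (by linarith), ← intervalIntegral.integral_of_le (by linarith),
    ← intervalIntegral.integral_comp_sub_left (fun t => F t),
    ← intervalIntegral.integral_comp_add_left (fun t => F t), ← intervalIntegral.integral_add]
  · rw [intervalIntegral.integral_of_le h1.le, integral_Ioc_eq_integral_Ioo,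
      setIntegral_congr_fun (g := fun _ => Complex.I) measurableSet_Ioo]
    · simp [h1.le]
    · intro s hs
      exact cauchyKernel_add_reflect ⟨h0.trans hs.1, hs.2⟩
  · refine ContinuousOn.intervalIntegrable_of_Icc h1.le ?_
    refine c2.comp (by fun_prop) fun s hs => ⟨by linarith [hs.2], by linarith [hs.1]⟩
  · refine ContinuousOn.intervalIntegrable_of_Icc h1.le ?_
    refine c1.comp (by fun_prop) fun s hs => ⟨by linarith [hs.1], by linarith [hs.2]⟩
  · rw [Set.disjoint_left]
    rintro t ⟨_, h2⟩ ⟨h3, _⟩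
    linarith

lemma DiniAt.integrableOn_mul {φ : ℂ → ℂ} {ζ : ℂ} (h : DiniAt φ ζ) :
    IntegrableOn (fun t : ℝ => (φ (circlePt t) - φ ζ) / (circlePt t - ζ) *
      (Complex.I * circlePt t)) (Ioc 0 (2 * π)) := by
  refine Integrable.mul_bdd (c := 1) h (Continuous.aestronglyMeasurable (by fun_prop)) ?_
  exact Eventually.of_forall fun t => by simp [norm_circlePt]

lemma DiniAt.tendsto_hilbertTrunc {φ : ℂ → ℂ} {θ : ℝ} (h : DiniAt φ (circlePt θ)) :
    Tendsto (fun ε : ℝ => hilbertTrunc φ θ ε) (𝓝[>] (0 : ℝ)) (𝓝 (hilb φ (circlePt θ))) := by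
  set ζ := circlePt θ with hζ
  set K : ℂ → ℂ := fun w => (φ w - φ ζ) / (w - ζ) * (Complex.I * w) with hK
  have hKi : IntegrableOn (fun t => K (circlePt t)) (Ioc (θ - π) (θ + π)) :=
    integrableOn_Ioc_circlePt h.integrableOn_mul (by linarith [Real.pi_pos])
  have hKe : ∫ t in Ioc (θ - π) (θ + π), K (circlePt t) =
      ∫ t in Ioc 0 (2 * π), K (circlePt t) := by
    have := setIntegral_Ioc_circlePt K (θ - π) 0
    rwa [show θ - π + 2 * π = θ + π by ring, zero_add] at this
  have hlim : Tendsto (fun ε : ℝ => ∫ t in Ioc (θ - π) (θ + π) \ Ioo (θ - ε) (θ + ε),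
      K (circlePt t)) (𝓝[>] 0) (𝓝 (∫ t in Ioc (θ - π) (θ + π), K (circlePt t))) := by
    have hconv : ∀ ε : ℝ, ∫ t in Ioc (θ - π) (θ + π) \ Ioo (θ - ε) (θ + ε), K (circlePt t) =
        ∫ t in Ioc (θ - π) (θ + π), (Ioo (θ - ε) (θ + ε))ᶜ.indicator (fun t => K (circlePt t)) t := by
      intro ε
      rw [setIntegral_indicator measurableSet_Ioo.compl, sdiff_eq]
    simp_rw [hconv]
    refine tendsto_integral_filter_of_dominated_convergence (fun t => ‖K (circlePt t)‖)
      (Eventually.of_forall fun ε => hKi.aestronglyMeasurable.indicator measurableSet_Ioo.compl)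
      (Eventually.of_forall fun ε => Eventually.of_forall fun t => norm_indicator_le_norm_self _ _)
      hKi.norm ?_
    filter_upwards [ae_restrict_of_ae (Measure.ae_ne volume θ)] with t ht
    refine tendsto_const_nhds.congr' ?_
    have hpos : 0 < |t - θ| := abs_pos.2 (sub_ne_zero.2 ht)
    filter_upwards [Ioo_mem_nhdsGT hpos] with ε hε
    rw [indicator_of_mem]
    intro hmem
    have : |t - θ| < ε := abs_lt.2 ⟨by linarith [hmem.1], by linarith [hmem.2]⟩
    linarith [hε.2]
  have hform : ∀ᶠ ε : ℝ in 𝓝[>] 0, (π * Complex.I)⁻¹ *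
      ((∫ t in Ioc (θ - π) (θ + π) \ Ioo (θ - ε) (θ + ε), K (circlePt t)) +
        φ ζ * ((π - ε) * Complex.I)) = hilbertTrunc φ θ ε := by
    filter_upwards [Ioo_mem_nhdsGT Real.pi_pos] with ε hε
    obtain ⟨i1, e1⟩ := integral_cauchyKernel_trunc (θ := θ) hε.1 hε.2
    rw [hilbertTrunc, ← e1, ← integral_const_mul, ← integral_add (hKi.mono_set sdiff_subset)
      (i1.const_mul _)]
    congr 1
    refine integral_congr_ae ?_
    filter_upwards with t
    rw [hK]
    ring
  refine Tendsto.congr' hform ?_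
  have hid : Tendsto (fun ε : ℝ => φ ζ * ((π - ε) * Complex.I)) (𝓝[>] 0)
      (𝓝 (φ ζ * ((π - (0 : ℝ)) * Complex.I))) := by
    refine (Continuous.tendsto ?_ 0).mono_left nhdsWithin_le_nhds
    fun_prop
  have := (hlim.add hid).const_mul ((π * Complex.I)⁻¹)
  convert this using 2
  rw [hKe, hilb, mul_add, add_comm]
  congr 1
  have : (π : ℂ) ≠ 0 := by exact_mod_cast Real.pi_ne_zero
  have hI := Complex.I_ne_zero
  simp only [Complex.ofReal_zero, sub_zero]
  field_simp

lemma circlePt_sub_ne_of_mem_disk {z : ℂ} (hz : z ∈ unitDiskSet) (t : ℝ) :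
    circlePt t - z ≠ 0 := by
  intro h
  have h1 : ‖z‖ < 1 := by simpa [unitDiskSet] using hz
  rw [← sub_eq_zero.1 h, norm_circlePt] at h1
  exact lt_irrefl _ h1

lemma two_pi_I_inv_mul_integral_cauchyKernel {z : ℂ} (hz : z ∈ unitDiskSet) :
    (2 * π * Complex.I)⁻¹ * ∫ t in Ioc (0 : ℝ) (2 * π),
      1 / (circlePt t - z) * (Complex.I * circlePt t) = 1 := by
  have h := circleIntegral.integral_sub_inv_of_mem_ball (c := 0) (R := 1) (w := z) hz
  rw [circleIntegral, intervalIntegral.integral_of_le (by positivity)] at h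
  have e : ∫ t in Ioc (0 : ℝ) (2 * π), 1 / (circlePt t - z) * (Complex.I * circlePt t) =
      2 * π * Complex.I := by
    rw [← h]
    refine integral_congr_ae (Eventually.of_forall fun t => ?_)
    simp only [deriv_circleMap, circlePt_eq_circleMap, smul_eq_mul]
    ring
  rw [e, inv_mul_cancel₀]
  exact Complex.two_pi_I_ne_zero

lemma integrableOn_szego {φ : ℂ → ℂ}
    (hφ : IntegrableOn (fun θ : ℝ => φ (circlePt θ)) (Ioc 0 (2 * π)))
    {z : ℂ} (hz : z ∈ unitDiskSet) :
    IntegrableOn (fun t : ℝ => φ (circlePt t) / (circlePt t - z) * (Complex.I * circlePt t))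
      (Ioc 0 (2 * π)) := by
  have hc : Continuous fun t : ℝ => (circlePt t - z)⁻¹ * (Complex.I * circlePt t) :=
    (Continuous.inv₀ (by fun_prop) (circlePt_sub_ne_of_mem_disk hz)).mul (by fun_prop)
  have hφ' : IntegrableOn (fun θ : ℝ => φ (circlePt θ)) (Icc 0 (2 * π)) := by
    rwa [integrableOn_Icc_iff_integrableOn_Ioc]
  have h := (hφ'.mul_continuousOn hc.continuousOn isCompact_Icc).mono_set
    (Ioc_subset_Icc_self (a := 0) (b := 2 * π))
  refine h.congr_fun (fun t _ => ?_) measurableSet_Ioc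
  simp only
  ring

lemma integrableOn_circlePt_const (c : ℂ) :
    IntegrableOn (fun _ : ℝ => c) (Ioc 0 (2 * π)) :=
  integrableOn_const (by simp [ENNReal.mul_eq_top])

lemma szego_add {φ ψ : ℂ → ℂ}
    (hφ : IntegrableOn (fun θ : ℝ => φ (circlePt θ)) (Ioc 0 (2 * π)))
    (hψ : IntegrableOn (fun θ : ℝ => ψ (circlePt θ)) (Ioc 0 (2 * π)))
    {z : ℂ} (hz : z ∈ unitDiskSet) :
    szego (fun ζ => φ ζ + ψ ζ) z = szego φ z + szego ψ z := by
  rw [szego, szego, szego, ← mul_add, ← integral_add (integrableOn_szego hφ hz)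
    (integrableOn_szego hψ hz)]
  simp_rw [add_div, add_mul]

lemma szego_const_mul (c : ℂ) (φ : ℂ → ℂ) (z : ℂ) :
    szego (fun ζ => c * φ ζ) z = c * szego φ z := by
  have h : ∫ t in Ioc (0 : ℝ) (2 * π), c * φ (circlePt t) / (circlePt t - z) *
      (Complex.I * circlePt t) = c * ∫ t in Ioc (0 : ℝ) (2 * π),
        φ (circlePt t) / (circlePt t - z) * (Complex.I * circlePt t) := by
    rw [← integral_const_mul]
    congr 1
    ext t
    ring
  rw [szego, szego, h, mul_left_comm]

lemma szego_const (c : ℂ) {z : ℂ} (hz : z ∈ unitDiskSet) : szego (fun _ => c) z = c := by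
  have h := szego_const_mul c (fun _ => 1) z
  rw [szego.eq_1 (fun _ => 1), two_pi_I_inv_mul_integral_cauchyKernel hz] at h
  simpa using h

lemma szego_eq_add {φ : ℂ → ℂ}
    (hφ : IntegrableOn (fun θ : ℝ => φ (circlePt θ)) (Ioc 0 (2 * π)))
    {z : ℂ} (hz : z ∈ unitDiskSet) (c : ℂ) :
    szego φ z = c + szego (fun ζ => φ ζ - c) z := by
  have h := szego_add (φ := fun _ => c) (ψ := fun ζ => φ ζ - c) (integrableOn_circlePt_const c)
    (Integrable.sub hφ (integrableOn_circlePt_const c)) hz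
  rw [szego_const c hz] at h
  rw [← h]
  simp

lemma szego_congr {φ ψ : ℂ → ℂ} (h : CircleAE fun ζ => φ ζ = ψ ζ) : szego φ = szego ψ := by
  funext z
  rw [szego, szego]
  congr 1
  refine integral_congr_ae ?_
  filter_upwards [h] with t ht
  rw [ht]

lemma infDist_frontier_unitDiskSet_le {ζ : ℂ} (hζ : ζ ∈ unitCircleSet) (z : ℂ) :
    Metric.infDist z (frontier unitDiskSet) ≤ ‖ζ - z‖ := by
  rw [unitDiskSet, frontier_ball _ one_ne_zero, ← dist_eq_norm, dist_comm]
  exact Metric.infDist_le_dist_of_mem hζ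

lemma DiniAt.hasNTLimAt_szego {φ : ℂ → ℂ}
    (hφ : IntegrableOn (fun θ : ℝ => φ (circlePt θ)) (Ioc 0 (2 * π)))
    {ζ : ℂ} (hd : DiniAt φ ζ) :
    HasNTLimAt (szego φ) unitDiskSet ((φ ζ + hilb φ ζ) / 2) ζ := by
  intro M hM
  have hform : ∀ᶠ z in 𝓝[ntRegion unitDiskSet ζ M] ζ,
      φ ζ + szego (fun w => φ w - φ ζ) z = szego φ z := by
    filter_upwards [self_mem_nhdsWithin] with z hz
    exact (szego_eq_add hφ hz.1 _).symm
  refine Tendsto.congr' hform ?_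
  have hval : (φ ζ + hilb φ ζ) / 2 = φ ζ + (2 * π * Complex.I)⁻¹ *
      ∫ t in Ioc (0 : ℝ) (2 * π),
        (φ (circlePt t) - φ ζ) / (circlePt t - ζ) * (Complex.I * circlePt t) := by
    rw [hilb]
    simp only [mul_inv]
    ring
  rw [hval]
  refine tendsto_const_nhds.add (Tendsto.const_mul _ ?_)
  have hbd : ∀ z ∈ ntRegion unitDiskSet ζ M, ∀ t : ℝ,
      ‖circlePt t - ζ‖ ≤ (1 + M) * ‖circlePt t - z‖ := by
    intro z hz t
    have h1 := infDist_frontier_unitDiskSet_le (circlePt_mem t) z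
    have h2 : ‖z - ζ‖ ≤ M * ‖circlePt t - z‖ :=
      hz.2.le.trans (mul_le_mul_of_nonneg_left h1 (by linarith))
    calc ‖circlePt t - ζ‖ = ‖(circlePt t - z) + (z - ζ)‖ := by ring_nf
      _ ≤ ‖circlePt t - z‖ + ‖z - ζ‖ := norm_add_le _ _
      _ ≤ _ := by linarith
  have : (𝓝[ntRegion unitDiskSet ζ M] ζ).IsCountablyGenerated := by
    unfold nhdsWithin; infer_instance
  refine tendsto_integral_filter_of_dominated_convergence
    (fun t => (1 + M) * ‖(φ (circlePt t) - φ ζ) / (circlePt t - ζ)‖) ?_ ?_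
    (Integrable.const_mul hd.norm _) ?_
  · filter_upwards [self_mem_nhdsWithin] with z hz
    exact (integrableOn_szego (φ := fun w => φ w - φ ζ)
      (Integrable.sub hφ (integrableOn_circlePt_const _)) hz.1).aestronglyMeasurable
  · filter_upwards [self_mem_nhdsWithin] with z hz
    refine Eventually.of_forall fun t => ?_
    rw [norm_mul, norm_mul, Complex.norm_I, norm_circlePt, mul_one, mul_one, norm_div, norm_div]
    by_cases ht : circlePt t - ζ = 0
    · simp [sub_eq_zero.1 ht]
    · have h1 := hbd z hz t
      have h2 := norm_pos_iff.2 ht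
      have h3 := norm_pos_iff.2 (circlePt_sub_ne_of_mem_disk hz.1 t)
      rw [← mul_div_assoc, div_le_div_iff₀ h3 h2]
      nlinarith [norm_nonneg (φ (circlePt t) - φ ζ)]
  · refine Eventually.of_forall fun t => ?_
    by_cases ht : circlePt t - ζ = 0
    · simp [sub_eq_zero.1 ht, tendsto_const_nhds]
    · refine Tendsto.mul_const _ (Tendsto.div tendsto_const_nhds ?_ ht)
      exact (Continuous.tendsto (by fun_prop) ζ).mono_left nhdsWithin_le_nhds

/-! ### The analytic Besov energy in polar coordinates -/

lemma lintegral_unitDiskSet_polar {F : ℂ → ℝ≥0∞} (hF : Measurable F) :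
    ∫⁻ z in unitDiskSet, F z = ∫⁻ x in Ioc 0 (2 * π), ∫⁻ δ in Ioo (0 : ℝ) 1,
      ENNReal.ofReal (1 - δ) * F (((1 - δ : ℝ) : ℂ) * circlePt x) := by
  have hD : MeasurableSet unitDiskSet := isOpen_ball.measurableSet
  rw [← lintegral_indicator hD, ← Complex.lintegral_comp_polarCoord_symm,
    polarCoord_target, Measure.volume_eq_prod, ← Measure.prod_restrict]
  have hpt : ∀ q : ℝ × ℝ, Complex.polarCoord.symm q = (q.1 : ℂ) * circlePt q.2 := by
    intro q
    rw [Complex.polarCoord_symm_apply, circlePt, Complex.exp_mul_I]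
    push_cast
    rfl
  simp_rw [hpt, smul_eq_mul]
  have hm1 : Measurable fun q : ℝ × ℝ => (q.1 : ℂ) * circlePt q.2 :=
    (Complex.measurable_ofReal.comp measurable_fst).mul (measurable_circlePt.comp measurable_snd)
  have hm2 : Measurable (unitDiskSet.indicator F) := hF.indicator hD
  rw [lintegral_prod_symm']
  swap
  · exact (measurable_fst.ennreal_ofReal).mul (hm2.comp hm1)
  have hin : ∀ y : ℝ, ∫⁻ x in Ioi (0 : ℝ), ENNReal.ofReal x *
      unitDiskSet.indicator F ((x : ℂ) * circlePt y) = ∫⁻ δ in Ioo (0 : ℝ) 1,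
      ENNReal.ofReal (1 - δ) * F (((1 - δ : ℝ) : ℂ) * circlePt y) := by
    intro y
    have e1 : ∫⁻ x in Ioi (0 : ℝ), ENNReal.ofReal x *
      unitDiskSet.indicator F ((x : ℂ) * circlePt y) = ∫⁻ x in Ioo (0 : ℝ) 1,
        ENNReal.ofReal x * F ((x : ℂ) * circlePt y) := by
      rw [← lintegral_indicator measurableSet_Ioi, ← lintegral_indicator measurableSet_Ioo]
      refine lintegral_congr fun x => ?_
      by_cases h0 : 0 < x
      · rw [indicator_of_mem (show x ∈ Ioi (0 : ℝ) from h0)]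
        have hn : ‖(x : ℂ) * circlePt y‖ = x := by
          rw [norm_mul, norm_circlePt, mul_one, Complex.norm_real, Real.norm_of_nonneg h0.le]
        by_cases h1 : x < 1
        · rw [indicator_of_mem (show x ∈ Ioo (0 : ℝ) 1 from ⟨h0, h1⟩), indicator_of_mem]
          rw [unitDiskSet, mem_ball_zero_iff, hn]
          exact h1
        · rw [indicator_of_notMem (show x ∉ Ioo (0 : ℝ) 1 from fun h => h1 h.2),
            indicator_of_notMem, mul_zero]
          rw [unitDiskSet, mem_ball_zero_iff, hn]
          exact h1
      · rw [indicator_of_notMem (show x ∉ Ioi (0 : ℝ) from h0),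
          indicator_of_notMem (show x ∉ Ioo (0 : ℝ) 1 from fun h => h0 h.1)]
    rw [e1]
    have mp := (Measure.measurePreserving_sub_left (volume : Measure ℝ) 1)
    have := mp.setLIntegral_comp_preimage_emb (MeasurableEquiv.subLeft (1 : ℝ)).measurableEmbedding
      (fun x => ENNReal.ofReal x * F ((x : ℂ) * circlePt y)) (Ioo 0 1)
    rw [← this, Set.preimage_const_sub_Ioo]
    norm_num
  simp_rw [hin]
  rw [restrict_Ioo_eq_restrict_Ioc]
  have := lintegral_Ioc_periodic (F := fun y => ∫⁻ δ in Ioo (0 : ℝ) 1,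
      ENNReal.ofReal (1 - δ) * F (((1 - δ : ℝ) : ℂ) * circlePt y))
    (fun y => by simp only [circlePt_periodic y]) (-π) 0
  rwa [show -π + 2 * π = π by ring, zero_add] at this

/-- The radial integrand equivalent to the one of the analytic Besov energy. -/
def radialEnergy (p : ℝ) (f : ℂ → ℂ) (x δ : ℝ) : ℝ≥0∞ :=
  ENNReal.ofReal (‖deriv f (((1 - δ : ℝ) : ℂ) * circlePt x)‖ ^ p * δ ^ (p - 2))

lemma analyticBesovEnergy_integrand {p : ℝ} {f : ℂ → ℂ} {x δ : ℝ} (hδ : δ ∈ Ioo (0 : ℝ) 1) :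
    ENNReal.ofReal ((‖deriv f (((1 - δ : ℝ) : ℂ) * circlePt x)‖ *
      (rhoD (((1 - δ : ℝ) : ℂ) * circlePt x))⁻¹) ^ p *
      rhoD (((1 - δ : ℝ) : ℂ) * circlePt x) ^ 2) =
    ENNReal.ofReal ((2 - δ) ^ (p - 2)) * radialEnergy p f x δ := by
  have h1 : 0 < 2 - δ := by linarith [hδ.2]
  have hn : ‖((1 - δ : ℝ) : ℂ) * circlePt x‖ = 1 - δ := by
    rw [norm_mul, norm_circlePt, mul_one, Complex.norm_real,
      Real.norm_of_nonneg (by linarith [hδ.2])]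
  rw [radialEnergy, ← ENNReal.ofReal_mul (by positivity)]
  congr 1
  rw [rhoD, hn, show 1 - (1 - δ) ^ 2 = δ * (2 - δ) by ring, inv_inv,
    Real.mul_rpow (norm_nonneg _) (mul_pos hδ.1 h1).le]
  have : (δ * (2 - δ)) ^ p * ((δ * (2 - δ))⁻¹) ^ 2 = δ ^ (p - 2) * (2 - δ) ^ (p - 2) := by
    rw [← Real.mul_rpow hδ.1.le h1.le, Real.rpow_sub (mul_pos hδ.1 h1), Real.rpow_two, inv_pow,
      div_eq_mul_inv]
  rw [mul_assoc, this]
  ring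

lemma two_sub_rpow_le {q δ : ℝ} (hδ : δ ∈ Ioo (0 : ℝ) 1) : (2 - δ) ^ q ≤ (2 : ℝ) ^ |q| := by
  refine (Real.rpow_le_rpow_of_exponent_le (by linarith [hδ.2]) (le_abs_self q)).trans
    (Real.rpow_le_rpow (by linarith [hδ.2]) (by linarith [hδ.1]) (abs_nonneg q))

lemma le_two_sub_rpow {q δ : ℝ} (hδ : δ ∈ Ioo (0 : ℝ) 1) : (2 : ℝ) ^ (-|q|) ≤ (2 - δ) ^ q := by
  have h := two_sub_rpow_le (q := -q) hδ
  rw [abs_neg, Real.rpow_neg (by linarith [hδ.2])] at h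
  rw [Real.rpow_neg zero_le_two]
  exact inv_le_of_inv_le₀ (Real.rpow_pos_of_pos (by linarith [hδ.2]) _) h

lemma measurable_analyticBesovEnergy_integrand (p : ℝ) (f : ℂ → ℂ) :
    Measurable fun z => ENNReal.ofReal ((‖deriv f z‖ * (rhoD z)⁻¹) ^ p * (rhoD z) ^ 2) := by
  have h2 : Measurable rhoD := (measurable_const.sub (measurable_norm.pow_const 2)).inv
  exact ((((measurable_deriv f).norm.mul h2.inv).pow_const p).mul (h2.pow_const 2)).ennreal_ofReal

lemma analyticBesovEnergy_le (p : ℝ) (f : ℂ → ℂ) :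
    analyticBesovEnergy p f ≤ ENNReal.ofReal (2 ^ |p - 2|) *
      ∫⁻ x in Ioc 0 (2 * π), ∫⁻ δ in Ioo (0 : ℝ) 1, radialEnergy p f x δ := by
  rw [analyticBesovEnergy, lintegral_unitDiskSet_polar
    (measurable_analyticBesovEnergy_integrand p f),
    ← lintegral_const_mul' _ _ ENNReal.ofReal_ne_top]
  refine lintegral_mono fun x => ?_
  rw [← lintegral_const_mul' _ _ ENNReal.ofReal_ne_top]
  refine setLIntegral_mono' measurableSet_Ioo fun δ hδ => ?_
  rw [analyticBesovEnergy_integrand hδ]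
  calc _ ≤ 1 * (ENNReal.ofReal ((2 - δ) ^ (p - 2)) * radialEnergy p f x δ) := by
        gcongr
        exact ENNReal.ofReal_le_one.2 (by linarith [hδ.1])
    _ ≤ _ := by
        rw [one_mul]
        gcongr
        exact two_sub_rpow_le hδ

lemma lintegral_radialEnergy_le (p : ℝ) (f : ℂ → ℂ) :
    ∫⁻ x in Ioc 0 (2 * π), ∫⁻ δ in Ioo (0 : ℝ) (4 / 5), radialEnergy p f x δ ≤
      ENNReal.ofReal (5 * 2 ^ |p - 2|) * analyticBesovEnergy p f := by
  rw [analyticBesovEnergy, lintegral_unitDiskSet_polar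
    (measurable_analyticBesovEnergy_integrand p f),
    ← lintegral_const_mul' _ _ ENNReal.ofReal_ne_top]
  refine lintegral_mono fun x => ?_
  rw [← lintegral_const_mul' _ _ ENNReal.ofReal_ne_top]
  refine (setLIntegral_mono' measurableSet_Ioo fun δ hδ => ?_).trans
    (lintegral_mono_set (Ioo_subset_Ioo_right (by norm_num)))
  have hδ' : δ ∈ Ioo (0 : ℝ) 1 := ⟨hδ.1, hδ.2.trans (by norm_num)⟩
  rw [analyticBesovEnergy_integrand hδ', ← mul_assoc, ← mul_assoc,
    ← ENNReal.ofReal_mul (by positivity),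
    ← ENNReal.ofReal_mul (mul_nonneg (by positivity) (by linarith [hδ'.2]))]
  refine le_mul_of_one_le_left zero_le (ENNReal.one_le_ofReal.2 ?_)
  have h := le_two_sub_rpow (q := p - 2) hδ'
  have h5 : 1 ≤ 5 * (1 - δ) := by linarith [hδ.2]
  have h2 : (2 : ℝ) ^ |p - 2| * 2 ^ (-|p - 2|) = 1 := by
    rw [← Real.rpow_add two_pos]; simp
  calc (1 : ℝ) = 1 * (2 ^ |p - 2| * 2 ^ (-|p - 2|)) := by rw [h2, one_mul]
    _ ≤ (5 * (1 - δ)) * (2 ^ |p - 2| * (2 - δ) ^ (p - 2)) := by gcongr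
    _ = _ := by ring

/-! ### The Szegő projection into the analytic Besov space -/

lemma hasDerivAt_szego {φ : ℂ → ℂ}
    (hφ : IntegrableOn (fun θ : ℝ => φ (circlePt θ)) (Ioc 0 (2 * π)))
    {z : ℂ} (hz : z ∈ unitDiskSet) :
    HasDerivAt (szego φ) ((2 * π * Complex.I)⁻¹ * ∫ t in Ioc (0 : ℝ) (2 * π),
      φ (circlePt t) / (circlePt t - z) ^ 2 * (Complex.I * circlePt t)) z := by
  have hz1 : ‖z‖ < 1 := mem_ball_zero_iff.1 hz
  set ε : ℝ := (1 - ‖z‖) / 2 with hε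
  have hε0 : 0 < ε := by rw [hε]; linarith
  have hw : ∀ w ∈ ball z ε, w ∈ unitDiskSet ∧ ∀ t, ε ≤ ‖circlePt t - w‖ := by
    intro w hw
    have h1 : ‖w‖ < 1 - ε := by
      have h2 : ‖w - z‖ < ε := mem_ball_iff_norm.1 hw
      have h3 := norm_le_norm_add_norm_sub' w z
      have h4 : ‖z‖ = 1 - 2 * ε := by rw [hε]; ring
      linarith
    refine ⟨mem_ball_zero_iff.2 (by linarith), fun t => ?_⟩
    have := norm_sub_norm_le (circlePt t) w
    rw [norm_circlePt] at this
    linarith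
  refine HasDerivAt.const_mul _ (hasDerivAt_integral_of_dominated_loc_of_deriv_le
    (F := fun w t => φ (circlePt t) / (circlePt t - w) * (Complex.I * circlePt t))
    (F' := fun w t => φ (circlePt t) / (circlePt t - w) ^ 2 * (Complex.I * circlePt t))
    (bound := fun t => ‖φ (circlePt t)‖ * (ε ^ 2)⁻¹)
    (ball_mem_nhds z hε0) ?_ (integrableOn_szego hφ hz) ?_ ?_ ?_ ?_).2
  · filter_upwards [ball_mem_nhds z hε0] with w hw'
    exact (integrableOn_szego hφ (hw w hw').1).aestronglyMeasurable
  · have hm : Measurable fun t => ((circlePt t - z) ^ 2)⁻¹ * (Complex.I * circlePt t) := by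
      have := measurable_circlePt
      fun_prop
    refine (hφ.aestronglyMeasurable.mul hm.aestronglyMeasurable).congr
      (Eventually.of_forall fun t => ?_)
    simp only [Pi.mul_apply]
    ring
  · refine Eventually.of_forall fun t w hw' => ?_
    rw [norm_mul, norm_div, norm_mul, norm_circlePt, Complex.norm_I, mul_one, mul_one, norm_pow,
      div_eq_mul_inv]
    have := (hw w hw').2 t
    gcongr
  · exact hφ.norm.mul_const _
  · refine Eventually.of_forall fun t w hw' => ?_
    have hne := circlePt_sub_ne_of_mem_disk (hw w hw').1 t
    have h1 : HasDerivAt (fun w => circlePt t - w) (-1) w := by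
      simpa using (hasDerivAt_id w).const_sub (circlePt t)
    have h2 := ((h1.inv hne).const_mul (φ (circlePt t))).mul_const (Complex.I * circlePt t)
    refine h2.congr_deriv ?_
    rw [neg_neg]
    ring

lemma deriv_szego {φ : ℂ → ℂ}
    (hφ : IntegrableOn (fun θ : ℝ => φ (circlePt θ)) (Ioc 0 (2 * π)))
    {z : ℂ} (hz : z ∈ unitDiskSet) (c : ℂ) :
    deriv (szego φ) z = (2 * π * Complex.I)⁻¹ * ∫ t in Ioc (0 : ℝ) (2 * π),
      (φ (circlePt t) - c) / (circlePt t - z) ^ 2 * (Complex.I * circlePt t) := by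
  have hφ' : IntegrableOn (fun θ : ℝ => φ (circlePt θ) - c) (Ioc 0 (2 * π)) :=
    Integrable.sub hφ (integrableOn_circlePt_const c)
  have h := (hasDerivAt_szego (φ := fun ζ => φ ζ - c) hφ' hz).const_add c
  refine (h.congr_of_eventuallyEq ?_).deriv
  filter_upwards [isOpen_ball.mem_nhds hz] with w hw
  exact szego_eq_add hφ hw c

lemma max_le_norm_circlePt_sub {s δ : ℝ} (hs : |s| ≤ π) (hδ : δ ∈ Ioo (0 : ℝ) 1) :
    max |s| δ / π ≤ ‖circlePt s - ((1 - δ : ℝ) : ℂ)‖ := by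
  have hpi := Real.pi_gt_three
  have h1 : δ ≤ ‖circlePt s - ((1 - δ : ℝ) : ℂ)‖ := by
    have := norm_sub_norm_le (circlePt s) ((1 - δ : ℝ) : ℂ)
    rw [norm_circlePt, Complex.norm_real, Real.norm_of_nonneg (by linarith [hδ.2])] at this
    linarith
  have h2 := le_norm_circlePt_sub_one hs
  have h3 : ‖circlePt s - 1‖ ≤ ‖circlePt s - ((1 - δ : ℝ) : ℂ)‖ + δ := by
    have : circlePt s - 1 = (circlePt s - ((1 - δ : ℝ) : ℂ)) - (δ : ℂ) := by push_cast; ring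
    rw [this]
    refine (norm_sub_le _ _).trans_eq ?_
    rw [Complex.norm_real, Real.norm_of_nonneg hδ.1.le]
  rw [div_le_iff₀ (by linarith), max_le_iff]
  constructor
  · rw [div_mul_eq_mul_div, div_le_iff₀ (by linarith)] at h2
    nlinarith
  · nlinarith [hδ.1]

lemma enorm_deriv_szego_le {φ : ℂ → ℂ}
    (hφ : IntegrableOn (fun θ : ℝ => φ (circlePt θ)) (Ioc 0 (2 * π)))
    (x : ℝ) {δ : ℝ} (hδ : δ ∈ Ioo (0 : ℝ) 1) :
    ‖deriv (szego φ) (((1 - δ : ℝ) : ℂ) * circlePt x)‖ₑ ≤ ENNReal.ofReal (π / 2) *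
      ∫⁻ s in Ioc (-π) π, ENNReal.ofReal (‖φ (circlePt (x + s)) - φ (circlePt x)‖ *
        max |s| δ ^ (-2 : ℝ)) := by
  have hz : ((1 - δ : ℝ) : ℂ) * circlePt x ∈ unitDiskSet := by
    rw [unitDiskSet, mem_ball_zero_iff, norm_mul, norm_circlePt, Complex.norm_real, mul_one,
      Real.norm_of_nonneg (by linarith [hδ.2])]
    linarith [hδ.1]
  have hpi := Real.pi_pos
  rw [deriv_szego hφ hz (φ (circlePt x)), enorm_mul]
  have e1 : ‖(2 * π * Complex.I : ℂ)⁻¹‖ₑ = ENNReal.ofReal ((2 * π)⁻¹) := by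
    rw [← ofReal_norm]
    congr 1
    rw [norm_inv, norm_mul, norm_mul, Complex.norm_I, Complex.norm_real,
      Real.norm_of_nonneg hpi.le]
    norm_num
  rw [e1, show π / 2 = (2 * π)⁻¹ * π ^ 2 by field_simp, ENNReal.ofReal_mul (by positivity),
    mul_assoc]
  gcongr
  refine (enorm_integral_le_lintegral_enorm _).trans ?_
  rw [lintegral_Ioc_circlePt_add (fun ζ => ‖(φ ζ - φ (circlePt x)) /
    (ζ - ((1 - δ : ℝ) : ℂ) * circlePt x) ^ 2 * (Complex.I * ζ)‖ₑ) x,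
    ← lintegral_const_mul' _ _ ENNReal.ofReal_ne_top]
  refine setLIntegral_mono' measurableSet_Ioc fun s hs => ?_
  rw [← ENNReal.ofReal_mul (by positivity), ← ofReal_norm]
  refine ENNReal.ofReal_le_ofReal ?_
  have hm : 0 < max |s| δ := lt_max_of_lt_right hδ.1
  have h := max_le_norm_circlePt_sub (abs_le.2 ⟨hs.1.le, hs.2⟩) hδ
  have hpos : 0 < ‖circlePt s - ((1 - δ : ℝ) : ℂ)‖ := (div_pos hm hpi).trans_le h
  rw [norm_mul, norm_mul, Complex.norm_I, norm_circlePt, norm_div, norm_pow, mul_one, mul_one,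
    circlePt_add, mul_comm (circlePt x), ← sub_mul, norm_mul (circlePt s - _), norm_circlePt,
    mul_one, Real.rpow_neg hm.le, Real.rpow_two, mul_left_comm, div_eq_mul_inv]
  gcongr
  rw [← div_eq_mul_inv, inv_le_comm₀ (by positivity) (by positivity), inv_div, ← div_pow]
  gcongr

lemma lintegral_kernel_le {p : ℝ} (hp : 1 < p) : ∃ C : ℝ, 0 < C ∧ ∀ g : ℝ → ℝ, Measurable g →
    (∀ s, 0 ≤ g s) → ∫⁻ δ in Ioo (0 : ℝ) 1, ENNReal.ofReal (δ ^ (p - 2)) *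
      (∫⁻ s in Ioc (-π) π, ENNReal.ofReal (g s * max |s| δ ^ (-2 : ℝ))) ^ p ≤
      ENNReal.ofReal C * ∫⁻ s in Ioc (-π) π,
        ENNReal.ofReal (g s ^ p / ‖circlePt s - 1‖ ^ (2 : ℕ)) := by
  have hp1 : 0 < p - 1 := by linarith
  obtain ⟨A, hA0, hA⟩ := lintegral_rpow_mul_max_rpow_le (α := 0) (β := 3 / 2)
    (by norm_num) (by norm_num)
  obtain ⟨B, hB0, hB⟩ := lintegral_rpow_mul_max_rpow_le (α := (p - 3) / 2) (β := (p + 3) / 2)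
    (by linarith) (by linarith)
  refine ⟨(2 * A) ^ (p - 1) * B, by positivity, fun g hg hg0 => ?_⟩
  have step1 : ∀ δ ∈ Ioo (0 : ℝ) 1, ENNReal.ofReal (δ ^ (p - 2)) *
      (∫⁻ s in Ioc (-π) π, ENNReal.ofReal (g s * max |s| δ ^ (-2 : ℝ))) ^ p ≤
      ENNReal.ofReal ((2 * A) ^ (p - 1)) * ∫⁻ s in Ioc (-π) π,
        ENNReal.ofReal (g s ^ p * (δ ^ ((p - 3) / 2) * max |s| δ ^ (-((p + 3) / 2)))) := by
    intro δ hδ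
    have hm : ∀ s : ℝ, 0 < max |s| δ := fun s => lt_max_of_lt_right hδ.1
    have hmm : Measurable fun s : ℝ => max |s| δ := measurable_norm.max measurable_const
    have h1 := lintegral_rpow_le_weight (μ := volume.restrict (Ioc (-π) π)) hp
      (G := fun s => g s * max |s| δ ^ (-2 : ℝ)) (W := fun s => max |s| δ)
      (hg.mul (hmm.pow_const _)).aemeasurable hmm.aemeasurable
      (Eventually.of_forall fun s => mul_nonneg (hg0 s) (Real.rpow_nonneg (hm s).le _))
      (Eventually.of_forall hm) (3 * (p - 1) / 2)
    have h2 : ∫⁻ s in Ioc (-π) π, ENNReal.ofReal (max |s| δ ^ (-(3 * (p - 1) / 2) / (p - 1))) ≤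
        ENNReal.ofReal (2 * A * δ ^ (-(1 / 2) : ℝ)) := by
      rw [lintegral_Ioc_abs (fun t => ENNReal.ofReal (max t δ ^ (-(3 * (p - 1) / 2) / (p - 1)))),
        mul_assoc, ENNReal.ofReal_mul zero_le_two, ENNReal.ofReal_ofNat]
      gcongr
      have h3 := hA δ hδ.1
      rw [show (0 : ℝ) + 1 - 3 / 2 = -(1 / 2) by norm_num] at h3
      refine le_trans ?_ h3
      refine (lintegral_mono_set Ioc_subset_Ioi_self).trans_eq ?_
      refine lintegral_congr fun t => ?_
      rw [Real.rpow_zero, one_mul]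
      congr 2
      field_simp
    have h4 : (∫⁻ s in Ioc (-π) π,
        ENNReal.ofReal (max |s| δ ^ (-(3 * (p - 1) / 2) / (p - 1)))) ^ (p - 1) ≤
        ENNReal.ofReal ((2 * A) ^ (p - 1) * δ ^ (-(p - 1) / 2)) := by
      refine (ENNReal.rpow_le_rpow h2 hp1.le).trans_eq ?_
      have := Real.rpow_nonneg hδ.1.le (-(1 / 2))
      rw [ENNReal.ofReal_rpow_of_nonneg (by positivity) hp1.le,
        Real.mul_rpow (by positivity) this, ← Real.rpow_mul hδ.1.le]
      congr 3
      ring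
    refine (mul_le_mul_right (h1.trans (mul_le_mul_right h4 _)) _).trans_eq ?_
    rw [mul_comm (∫⁻ s in Ioc (-π) π, _), ← mul_assoc,
      ← ENNReal.ofReal_mul (Real.rpow_nonneg hδ.1.le _),
      show δ ^ (p - 2) * ((2 * A) ^ (p - 1) * δ ^ (-(p - 1) / 2)) =
        (2 * A) ^ (p - 1) * δ ^ ((p - 3) / 2) by
        rw [mul_left_comm, ← Real.rpow_add hδ.1]; congr 2; ring,
      ENNReal.ofReal_mul (by positivity), mul_assoc,
      ← lintegral_const_mul' _ _ ENNReal.ofReal_ne_top]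
    congr 1
    refine lintegral_congr fun s => ?_
    rw [← ENNReal.ofReal_mul (Real.rpow_nonneg hδ.1.le _),
      Real.mul_rpow (hg0 s) (Real.rpow_nonneg (hm s).le _), ← Real.rpow_mul (hm s).le,
      mul_assoc, ← Real.rpow_add (hm s), mul_left_comm]
    congr 4
    ring
  refine (setLIntegral_mono' measurableSet_Ioo step1).trans ?_
  rw [lintegral_const_mul' _ _ ENNReal.ofReal_ne_top, ENNReal.ofReal_mul (by positivity), mul_assoc]
  gcongr
  rw [lintegral_lintegral_swap]
  swap
  · refine Measurable.aemeasurable (Measurable.ennreal_ofReal ?_)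
    exact ((hg.comp measurable_snd).pow_const p).mul ((measurable_fst.pow_const _).mul
      ((measurable_norm.comp measurable_snd).max measurable_fst |>.pow_const _))
  rw [← lintegral_const_mul' _ _ ENNReal.ofReal_ne_top]
  have hne : ∀ᵐ s : ℝ ∂volume.restrict (Ioc (-π) π), s ≠ 0 :=
    ae_restrict_of_ae (by simp [ae_iff])
  refine lintegral_mono_ae ?_
  filter_upwards [hne, ae_restrict_mem measurableSet_Ioc] with s hs0 hs
  have hs' : 0 < |s| := abs_pos.2 hs0
  have h5 := hB |s| hs'
  rw [show (p - 3) / 2 + 1 - (p + 3) / 2 = (-2 : ℝ) by ring] at h5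
  have hc := pos_norm_circlePt_sub_one hs hs0
  calc _ = ENNReal.ofReal (g s ^ p) * ∫⁻ δ in Ioo (0 : ℝ) 1,
        ENNReal.ofReal (δ ^ ((p - 3) / 2) * max |s| δ ^ (-((p + 3) / 2))) := by
        rw [← lintegral_const_mul' _ _ ENNReal.ofReal_ne_top]
        refine lintegral_congr fun δ => ?_
        rw [ENNReal.ofReal_mul (Real.rpow_nonneg (hg0 s) _)]
    _ ≤ ENNReal.ofReal (g s ^ p) * ENNReal.ofReal (B * |s| ^ (-2 : ℝ)) := by
        gcongr
        refine le_trans ((lintegral_mono_set Ioo_subset_Ioi_self).trans_eq ?_) h5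
        refine lintegral_congr fun δ => ?_
        rw [max_comm]
    _ ≤ _ := by
        have hgp := Real.rpow_nonneg (hg0 s) p
        rw [← ENNReal.ofReal_mul hgp, ← ENNReal.ofReal_mul hB0.le]
        refine ENNReal.ofReal_le_ofReal ?_
        rw [Real.rpow_neg hs'.le, Real.rpow_two, mul_left_comm, div_eq_mul_inv]
        gcongr
        exact norm_circlePt_sub_one_le s

lemma exists_analyticBesovEnergy_szego_le {p : ℝ} (hp : 1 < p) : ∃ C : ℝ, 0 < C ∧
    ∀ φ : ℂ → ℂ, MemBesov p φ →
      analyticBesovEnergy p (szego φ) ≤ ENNReal.ofReal C * besovEnergy p φ := by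
  obtain ⟨C, hC0, hC⟩ := lintegral_kernel_le hp
  have hp0 : 0 < p := by linarith
  refine ⟨2 ^ |p - 2| * ((π / 2) ^ p * C), by positivity, fun φ₀ hφ₀ => ?_⟩
  obtain ⟨φ, hm, hae⟩ := exists_measurable_circleAE_eq hφ₀.1.aestronglyMeasurable
  have hφ : MemBesov p φ := memBesov_congr hae.symm hφ₀
  rw [← szego_congr hae, ← besovEnergy_congr p hae, besovEnergy_eq]
  refine (analyticBesovEnergy_le p _).trans ?_
  rw [ENNReal.ofReal_mul (by positivity), mul_assoc]
  gcongr
  rw [← lintegral_const_mul' _ _ ENNReal.ofReal_ne_top]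
  refine lintegral_mono fun x => ?_
  set g : ℝ → ℝ := fun s => ‖φ (circlePt (x + s)) - φ (circlePt x)‖ with hg
  have hgm : Measurable g := by
    have := measurable_circlePt
    fun_prop
  have h1 := hC g hgm (fun s => norm_nonneg _)
  rw [ENNReal.ofReal_mul (by positivity), mul_assoc]
  refine le_trans ?_ (mul_le_mul_right h1 _)
  rw [← lintegral_const_mul' _ _ ENNReal.ofReal_ne_top]
  refine setLIntegral_mono' measurableSet_Ioo fun δ hδ => ?_
  have h2 := ENNReal.rpow_le_rpow (enorm_deriv_szego_le hφ.1 x hδ) hp0.le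
  rw [ENNReal.mul_rpow_of_nonneg _ _ hp0.le,
    ENNReal.ofReal_rpow_of_nonneg (by positivity) hp0.le, ← ofReal_norm,
    ENNReal.ofReal_rpow_of_nonneg (norm_nonneg _) hp0.le] at h2
  rw [radialEnergy, ENNReal.ofReal_mul (by positivity), mul_left_comm, mul_comm]
  gcongr

/-! ### Boundary values of functions in the analytic Besov space -/

lemma lintegral_Ioc_comp_mul_le (q : ℝ) (G : ℝ → ℝ≥0∞) {k b : ℝ} (hk : 0 < k)
    (hkb : k * b < 4 / 5) :
    ∫⁻ s in Ioc 0 b, ENNReal.ofReal (s ^ q) * G (k * s) ≤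
      ENNReal.ofReal (k ^ (-q - 1)) * ∫⁻ τ in Ioo (0 : ℝ) (4 / 5), ENNReal.ofReal (τ ^ q) * G τ := by
  set H : ℝ → ℝ≥0∞ := (Ioc 0 (k * b)).indicator
    (fun τ => ENNReal.ofReal ((k⁻¹ * τ) ^ q) * G τ) with hH
  have e1 : ∫⁻ s in Ioc 0 b, ENNReal.ofReal (s ^ q) * G (k * s) = ∫⁻ s, H (k * s) := by
    rw [← lintegral_indicator measurableSet_Ioc]
    refine lintegral_congr fun s => ?_
    have hiff : k * s ∈ Ioc 0 (k * b) ↔ s ∈ Ioc 0 b := by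
      rw [mem_Ioc, mem_Ioc, mul_pos_iff_of_pos_left hk, mul_le_mul_iff_right₀ hk]
    by_cases hs : s ∈ Ioc 0 b
    · rw [hH, indicator_of_mem hs, indicator_of_mem (hiff.2 hs), inv_mul_cancel_left₀ hk.ne']
    · rw [hH, indicator_of_notMem hs, indicator_of_notMem (fun h => hs (hiff.1 h))]
  have hemb : MeasurableEmbedding fun s : ℝ => k * s :=
    (Homeomorph.mulLeft₀ k hk.ne').measurableEmbedding
  rw [e1, ← hemb.lintegral_map H, Real.map_volume_mul_left hk.ne', lintegral_smul_measure, hH,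
    lintegral_indicator measurableSet_Ioc, smul_eq_mul, abs_of_pos (inv_pos.2 hk),
    ← lintegral_const_mul' _ _ ENNReal.ofReal_ne_top,
    ← lintegral_const_mul' _ _ ENNReal.ofReal_ne_top]
  refine le_trans ?_ (lintegral_mono_set (s := Ioc 0 (k * b)) fun τ hτ => ⟨hτ.1, hτ.2.trans_lt hkb⟩)
  refine setLIntegral_mono' measurableSet_Ioc fun τ hτ => le_of_eq ?_
  rw [← mul_assoc, ← mul_assoc, ← ENNReal.ofReal_mul (by positivity),
    ← ENNReal.ofReal_mul (by positivity), Real.mul_rpow (by positivity) hτ.1.le, ← mul_assoc]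
  congr 3
  rw [Real.rpow_sub hk, Real.rpow_one, Real.rpow_neg hk.le, Real.inv_rpow hk.le]
  field_simp

/-- The modulus of the derivative at distance `δ` from the boundary point of angle `x`. -/
def radialDeriv (f : ℂ → ℂ) (x δ : ℝ) : ℝ := ‖deriv f (((1 - δ : ℝ) : ℂ) * circlePt x)‖

lemma radialDeriv_nonneg (f : ℂ → ℂ) (x δ : ℝ) : 0 ≤ radialDeriv f x δ := norm_nonneg _

lemma measurable_radialDeriv (f : ℂ → ℂ) :
    Measurable fun q : ℝ × ℝ => radialDeriv f q.1 q.2 := by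
  have h : Measurable fun q : ℝ × ℝ => ((1 - q.2 : ℝ) : ℂ) * circlePt q.1 :=
    (Complex.measurable_ofReal.comp (measurable_const.sub measurable_snd)).mul
      (measurable_circlePt.comp measurable_fst)
  exact ((measurable_deriv f).comp h).norm

lemma mul_circlePt_mem_disk (x : ℝ) {δ : ℝ} (h0 : 0 < δ) (h1 : δ < 2) :
    ((1 - δ : ℝ) : ℂ) * circlePt x ∈ unitDiskSet := by
  rw [unitDiskSet, mem_ball_zero_iff, norm_mul, norm_circlePt, Complex.norm_real, mul_one,
    Real.norm_eq_abs, abs_lt]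
  constructor <;> linarith

lemma enorm_sub_le_lintegral_deriv {f : ℂ → ℂ} (hf : DifferentiableOn ℂ f unitDiskSet)
    {c c' : ℝ → ℂ} (hc : ∀ t, HasDerivAt c (c' t) t) (hc' : Continuous c') {a b : ℝ} (hab : a ≤ b)
    (hD : ∀ t ∈ Icc a b, c t ∈ unitDiskSet) :
    ‖f (c b) - f (c a)‖ₑ ≤ ∫⁻ t in Ioc a b, ‖deriv f (c t) * c' t‖ₑ := by
  have hcc : Continuous c := continuous_iff_continuousAt.2 fun t => (hc t).continuousAt
  have hd : ∀ t ∈ uIcc a b, HasDerivAt (fun t => f (c t)) (deriv f (c t) * c' t) t := by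
    intro t ht
    rw [uIcc_of_le hab] at ht
    exact ((hf.differentiableAt (isOpen_ball.mem_nhds (hD t ht))).hasDerivAt).comp t (hc t)
  have hcont : ContinuousOn (fun t => deriv f (c t) * c' t) (uIcc a b) := by
    rw [uIcc_of_le hab]
    exact ((hf.deriv isOpen_ball).continuousOn.comp hcc.continuousOn hD).mul hc'.continuousOn
  rw [← intervalIntegral.integral_eq_sub_of_hasDerivAt hd hcont.intervalIntegrable,
    intervalIntegral.integral_of_le hab]
  exact enorm_integral_le_lintegral_enorm _

/-- The total variation of `f` along the radius of angle `x` between the boundary point and the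
point at distance `δ` from it. -/
def radialVar (f : ℂ → ℂ) (x δ : ℝ) : ℝ≥0∞ :=
  ∫⁻ v in Ioc (0 : ℝ) 1, ENNReal.ofReal (radialDeriv f x (δ * v) * δ)

lemma enorm_radial_sub_le {f : ℂ → ℂ} (hf : DifferentiableOn ℂ f unitDiskSet) (x : ℝ) {δ η : ℝ}
    (hδ : δ ∈ Ioo (0 : ℝ) 1) (hη : η ∈ Ioc (0 : ℝ) 1) :
    ‖f (((1 - δ * η : ℝ) : ℂ) * circlePt x) - f (((1 - δ : ℝ) : ℂ) * circlePt x)‖ₑ ≤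
      radialVar f x δ := by
  have hc : ∀ v : ℝ, HasDerivAt (fun v : ℝ => ((1 - δ * v : ℝ) : ℂ) * circlePt x)
      (((-δ : ℝ) : ℂ) * circlePt x) v := by
    intro v
    have h1 : HasDerivAt (fun v : ℝ => 1 - δ * v) (-δ) v := by
      simpa using ((hasDerivAt_id v).const_mul δ).const_sub 1
    exact (h1.ofReal_comp).mul_const _
  have h := enorm_sub_le_lintegral_deriv hf hc continuous_const hη.2 (fun v hv =>
    mul_circlePt_mem_disk x (mul_pos hδ.1 (hη.1.trans_le hv.1)) (by nlinarith [hδ.1, hδ.2, hv.2]))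
  rw [mul_one, enorm_sub_rev] at h
  refine h.trans ((lintegral_mono_set (Ioc_subset_Ioc_left hη.1.le)).trans_eq ?_)
  refine lintegral_congr fun v => ?_
  rw [← ofReal_norm, norm_mul, norm_mul, norm_circlePt, mul_one, Complex.norm_real, norm_neg,
    Real.norm_of_nonneg hδ.1.le, radialDeriv]

lemma enorm_boundary_sub_le {f : ℂ → ℂ} (hf : DifferentiableOn ℂ f unitDiskSet) {x : ℝ} {L : ℂ}
    (hL : Tendsto (fun r : ℝ => f ((r : ℂ) * circlePt x)) (𝓝[<] 1) (𝓝 L)) {δ : ℝ}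
    (hδ : δ ∈ Ioo (0 : ℝ) 1) :
    ‖L - f (((1 - δ : ℝ) : ℂ) * circlePt x)‖ₑ ≤ radialVar f x δ := by
  have ht : Tendsto (fun η : ℝ => 1 - δ * η) (𝓝[>] 0) (𝓝[<] 1) := by
    refine tendsto_nhdsWithin_iff.2 ⟨?_, ?_⟩
    · have : Continuous fun η : ℝ => 1 - δ * η := by fun_prop
      exact (this.tendsto' 0 1 (by simp)).mono_left nhdsWithin_le_nhds
    · filter_upwards [self_mem_nhdsWithin] with η hη
      have : 0 < δ * η := mul_pos hδ.1 hη
      rw [mem_Iio]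
      linarith
  have h2 := ((hL.comp ht).sub_const (f (((1 - δ : ℝ) : ℂ) * circlePt x))).enorm
  refine le_of_tendsto h2 ?_
  filter_upwards [Ioc_mem_nhdsGT (zero_lt_one' ℝ)] with η hη
  exact enorm_radial_sub_le hf x hδ hη

lemma enorm_arc_sub_le {f : ℂ → ℂ} (hf : DifferentiableOn ℂ f unitDiskSet) (x s : ℝ) {δ : ℝ}
    (hδ : δ ∈ Ioo (0 : ℝ) 1) :
    ‖f (((1 - δ : ℝ) : ℂ) * circlePt (x + s)) - f (((1 - δ : ℝ) : ℂ) * circlePt x)‖ₑ ≤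
      ∫⁻ v in Ioc (0 : ℝ) 1, ENNReal.ofReal (radialDeriv f (x + s * v) δ * |s|) := by
  have hc : ∀ v : ℝ, HasDerivAt (fun v : ℝ => ((1 - δ : ℝ) : ℂ) * circlePt (x + s * v))
      (((1 - δ : ℝ) : ℂ) * (circlePt (x + s * v) * ((s : ℂ) * Complex.I))) v := by
    intro v
    have h1 : HasDerivAt (fun v : ℝ => x + s * v) s v := by
      simpa using ((hasDerivAt_id v).const_mul s).const_add x
    exact ((h1.ofReal_comp.mul_const Complex.I).cexp).const_mul _
  have hcont : Continuous fun v : ℝ => ((1 - δ : ℝ) : ℂ) *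
      (circlePt (x + s * v) * ((s : ℂ) * Complex.I)) := by
    have := continuous_circlePt
    fun_prop
  have h := enorm_sub_le_lintegral_deriv hf hc hcont zero_le_one (fun v _ =>
    mul_circlePt_mem_disk _ hδ.1 (by linarith [hδ.2]))
  rw [mul_one, mul_zero, add_zero] at h
  refine h.trans (lintegral_mono fun v => ?_)
  rw [← ofReal_norm]
  refine ENNReal.ofReal_le_ofReal ?_
  rw [norm_mul, norm_mul, norm_mul, norm_mul, norm_circlePt, Complex.norm_I, Complex.norm_real,
    Complex.norm_real, mul_one, one_mul, Real.norm_of_nonneg (by linarith [hδ.2]),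
    Real.norm_eq_abs, radialDeriv]
  refine mul_le_mul_of_nonneg_left ?_ (norm_nonneg _)
  exact mul_le_of_le_one_left (abs_nonneg s) (by linarith [hδ.1])

lemma exists_radialVar_rpow_le {p : ℝ} (hp : 1 < p) : ∃ C : ℝ, 0 < C ∧
    ∀ (f : ℂ → ℂ) (x δ : ℝ), 0 ≤ δ → radialVar f x δ ^ p ≤ ENNReal.ofReal (C * δ ^ p) *
      ∫⁻ v in Ioc (0 : ℝ) 1, ENNReal.ofReal (v ^ (p - 3 / 2)) *
        ENNReal.ofReal (radialDeriv f x (δ * v) ^ p) := by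
  have hp1 : 0 < p - 1 := by linarith
  obtain ⟨a, ha⟩ : ∃ a : ℝ, a = 1 / (2 * (p - 1)) := ⟨_, rfl⟩
  have ha0 : 0 < a := by rw [ha]; positivity
  refine ⟨(1 / a) ^ (p - 1), by positivity, fun f x δ hδ => ?_⟩
  have hm : Measurable fun v => radialDeriv f x (δ * v) :=
    (measurable_radialDeriv f).comp (f := fun v : ℝ => (x, δ * v)) (by fun_prop)
  have h := lintegral_rpow_le_weight (μ := volume.restrict (Ioc (0 : ℝ) 1)) hp
    (G := fun v => radialDeriv f x (δ * v) * δ) (W := fun v => v)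
    (hm.mul_const δ).aemeasurable measurable_id.aemeasurable
    (Eventually.of_forall fun v => mul_nonneg (radialDeriv_nonneg _ _ _) hδ)
    ((ae_restrict_mem measurableSet_Ioc).mono fun v hv => hv.1) (p - 3 / 2)
  have e : -(p - 3 / 2) / (p - 1) = -1 + a := by rw [ha]; field_simp; ring
  rw [e, lintegral_Ioc_rpow (by linarith) one_pos, Real.one_rpow, neg_add_cancel_comm,
    ENNReal.ofReal_rpow_of_nonneg (by positivity) hp1.le, mul_comm] at h
  refine h.trans_eq ?_
  rw [ENNReal.ofReal_mul (by positivity), mul_assoc]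
  congr 1
  rw [← lintegral_const_mul' _ _ ENNReal.ofReal_ne_top]
  refine setLIntegral_congr_fun measurableSet_Ioc fun v hv => ?_
  have := Real.rpow_nonneg (radialDeriv_nonneg f x (δ * v)) p
  have := Real.rpow_nonneg hv.1.le (p - 3 / 2)
  rw [← ENNReal.ofReal_mul (by positivity), ← ENNReal.ofReal_mul (by positivity),
    Real.mul_rpow (radialDeriv_nonneg _ _ _) hδ]
  congr 1
  ring

lemma lintegral_rpow_le_lintegral_rpow {p : ℝ} (hp : 1 < p) {G : ℝ → ℝ} (hG : Measurable G)
    (hG0 : ∀ v, 0 ≤ G v) : (∫⁻ v in Ioc (0 : ℝ) 1, ENNReal.ofReal (G v)) ^ p ≤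
      ∫⁻ v in Ioc (0 : ℝ) 1, ENNReal.ofReal (G v ^ p) := by
  have h := lintegral_rpow_le_weight (μ := volume.restrict (Ioc (0 : ℝ) 1)) hp
    (G := G) (W := fun _ => 1) hG.aemeasurable measurable_const.aemeasurable
    (Eventually.of_forall hG0) (Eventually.of_forall fun _ => one_pos) 0
  simpa using h

lemma radialEnergy_eq (p : ℝ) (f : ℂ → ℂ) (x : ℝ) {δ : ℝ} (hδ : 0 < δ) :
    radialEnergy p f x δ = ENNReal.ofReal (δ ^ (p - 2)) * ENNReal.ofReal (radialDeriv f x δ ^ p) := by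
  rw [← ENNReal.ofReal_mul (Real.rpow_nonneg hδ.le _), mul_comm, radialEnergy, radialDeriv]

lemma add_three_rpow_le {p : ℝ} (hp : 0 ≤ p) (a b c : ℝ≥0∞) :
    (a + b + c) ^ p ≤ 3 ^ p * (a ^ p + b ^ p + c ^ p) := by
  have h : a + b + c ≤ 3 * max a (max b c) := by
    rw [show (3 : ℝ≥0∞) = 1 + 1 + 1 by norm_num, add_mul, add_mul, one_mul]
    gcongr <;> simp
  refine (ENNReal.rpow_le_rpow h hp).trans ?_
  rw [ENNReal.mul_rpow_of_nonneg _ _ hp]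
  gcongr
  rcases max_choice a (max b c) with h | h
  · rw [h]
    exact le_self_add.trans le_self_add
  · rw [h]
    rcases max_choice b c with h | h
    · rw [h]
      exact le_add_self.trans le_self_add
    · rw [h]
      exact le_add_self

/-- The `p`-th power of the modulus of the derivative along the radius of angle `x`. -/
def radialPow (p : ℝ) (f : ℂ → ℂ) (x δ : ℝ) : ℝ≥0∞ := ENNReal.ofReal (radialDeriv f x δ ^ p)

lemma measurable_radialPow (p : ℝ) (f : ℂ → ℂ) :
    Measurable fun q : ℝ × ℝ => radialPow p f q.1 q.2 :=
  ((measurable_radialDeriv f).pow_const p).ennreal_ofReal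

lemma radialPow_periodic (p : ℝ) (f : ℂ → ℂ) (δ : ℝ) :
    Function.Periodic (fun x => radialPow p f x δ) (2 * π) := fun x => by
  simp only [radialPow, radialDeriv, circlePt_periodic x]

lemma lintegral_abs_rpow_mul_radialPow_le (p : ℝ) (f : ℂ → ℂ) (x : ℝ) {k : ℝ} (hk : 0 < k)
    (hk' : k ≤ 1 / 4) :
    ∫⁻ s in Ioc (-π) π, ENNReal.ofReal (|s| ^ (p - 2)) * radialPow p f x (k * |s|) ≤
      ENNReal.ofReal (2 * k ^ (1 - p)) * ∫⁻ τ in Ioo (0 : ℝ) (4 / 5), radialEnergy p f x τ := by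
  have hpi := Real.pi_lt_d2
  have hkp : k * π < 4 / 5 := by nlinarith [Real.pi_pos]
  rw [lintegral_Ioc_abs (fun t => ENNReal.ofReal (t ^ (p - 2)) * radialPow p f x (k * t)),
    ENNReal.ofReal_mul zero_le_two, ENNReal.ofReal_ofNat, mul_assoc]
  gcongr
  refine (lintegral_Ioc_comp_mul_le (p - 2) (radialPow p f x) hk hkp).trans_eq ?_
  rw [show -(p - 2) - 1 = 1 - p by ring]
  congr 1
  exact setLIntegral_congr_fun measurableSet_Ioo fun τ hτ => (radialEnergy_eq p f x hτ.1).symm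

/-- The weighted mean of `radialPow` over the radius between the boundary and distance `s / 4`. -/
def radialMean (p : ℝ) (f : ℂ → ℂ) (x s : ℝ) : ℝ≥0∞ :=
  ∫⁻ v in Ioc (0 : ℝ) 1, ENNReal.ofReal (v ^ (p - 3 / 2)) * radialPow p f x (s / 4 * v)

/-- The mean of `radialPow` at distance `|s| / 4` from the boundary over an arc of length `|s|`. -/
def arcMean (p : ℝ) (f : ℂ → ℂ) (x s : ℝ) : ℝ≥0∞ :=
  ∫⁻ v in Ioc (0 : ℝ) 1, radialPow p f (x + s * v) (|s| / 4)

lemma measurable_radialMean (p : ℝ) (f : ℂ → ℂ) :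
    Measurable fun q : ℝ × ℝ => radialMean p f q.1 q.2 := by
  refine Measurable.lintegral_prod_right'
    (f := fun q : (ℝ × ℝ) × ℝ => ENNReal.ofReal (q.2 ^ (p - 3 / 2)) *
      radialPow p f q.1.1 (q.1.2 / 4 * q.2)) ?_
  refine Measurable.mul (measurable_snd.pow_const _).ennreal_ofReal ?_
  exact (measurable_radialPow p f).comp
    (f := fun q : (ℝ × ℝ) × ℝ => (q.1.1, q.1.2 / 4 * q.2)) (by fun_prop)

lemma radialMean_periodic (p : ℝ) (f : ℂ → ℂ) (s : ℝ) :
    Function.Periodic (fun x => radialMean p f x s) (2 * π) := fun x => by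
  simp only [radialMean, radialPow, radialDeriv, circlePt_periodic x]

lemma lintegral_radialMean_le {p : ℝ} (f : ℂ → ℂ) (x : ℝ) :
    ∫⁻ s in Ioc (-π) π, ENNReal.ofReal (|s| ^ (p - 2)) * radialMean p f x |s| ≤
      ENNReal.ofReal (4 * 4 ^ (p - 1)) *
        ∫⁻ τ in Ioo (0 : ℝ) (4 / 5), radialEnergy p f x τ := by
  have hmeas : Measurable fun q : ℝ × ℝ => ENNReal.ofReal (|q.1| ^ (p - 2)) *
      (ENNReal.ofReal (q.2 ^ (p - 3 / 2)) * radialPow p f x (|q.1| / 4 * q.2)) := by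
    refine Measurable.mul (measurable_fst.norm.pow_const _).ennreal_ofReal
      (Measurable.mul (measurable_snd.pow_const _).ennreal_ofReal ?_)
    refine (measurable_radialPow p f).comp (f := fun q : ℝ × ℝ => (x, |q.1| / 4 * q.2)) ?_
    exact measurable_const.prodMk ((measurable_fst.norm.div_const 4).mul measurable_snd)
  have e1 : ∫⁻ s in Ioc (-π) π, ENNReal.ofReal (|s| ^ (p - 2)) * radialMean p f x |s| =
      ∫⁻ v in Ioc (0 : ℝ) 1, ∫⁻ s in Ioc (-π) π, ENNReal.ofReal (|s| ^ (p - 2)) *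
        (ENNReal.ofReal (v ^ (p - 3 / 2)) * radialPow p f x (|s| / 4 * v)) := by
    rw [← lintegral_lintegral_swap hmeas.aemeasurable]
    refine lintegral_congr fun s => ?_
    rw [radialMean, lintegral_const_mul' _ _ ENNReal.ofReal_ne_top]
  rw [e1]
  have e2 : ∀ v ∈ Ioc (0 : ℝ) 1, ∫⁻ s in Ioc (-π) π, ENNReal.ofReal (|s| ^ (p - 2)) *
        (ENNReal.ofReal (v ^ (p - 3 / 2)) * radialPow p f x (|s| / 4 * v)) ≤
      ENNReal.ofReal (v ^ (-(1 / 2) : ℝ)) * (ENNReal.ofReal (2 * 4 ^ (p - 1)) *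
        ∫⁻ τ in Ioo (0 : ℝ) (4 / 5), radialEnergy p f x τ) := by
    intro v hv
    have h := lintegral_abs_rpow_mul_radialPow_le p f x (k := v / 4) (by linarith [hv.1])
      (by linarith [hv.2])
    have h0 := Real.rpow_nonneg hv.1.le (p - 3 / 2)
    calc _ = ENNReal.ofReal (v ^ (p - 3 / 2)) * ∫⁻ s in Ioc (-π) π,
          ENNReal.ofReal (|s| ^ (p - 2)) * radialPow p f x (v / 4 * |s|) := by
          rw [← lintegral_const_mul' _ _ ENNReal.ofReal_ne_top]
          refine lintegral_congr fun s => ?_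
          rw [mul_left_comm, show |s| / 4 * v = v / 4 * |s| by ring]
      _ ≤ _ := mul_le_mul_right h _
      _ = _ := by
          rw [← mul_assoc, ← mul_assoc, ← ENNReal.ofReal_mul h0,
            ← ENNReal.ofReal_mul (Real.rpow_nonneg hv.1.le _)]
          congr 2
          rw [Real.div_rpow hv.1.le (by norm_num), show p - 1 = -(1 - p) by ring,
            Real.rpow_neg (by norm_num : (0 : ℝ) ≤ 4),
            show (-(1 / 2) : ℝ) = (p - 3 / 2) + (1 - p) by ring, Real.rpow_add hv.1]
          field_simp
  refine (setLIntegral_mono' measurableSet_Ioc e2).trans_eq ?_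
  rw [lintegral_mul_const]
  swap
  · exact (measurable_id.pow_const _).ennreal_ofReal
  rw [lintegral_Ioc_rpow (by norm_num) one_pos, ← mul_assoc, ← ENNReal.ofReal_mul (by norm_num)]
  congr 2
  norm_num
  ring

lemma lintegral_swap_shift {W : ℝ → ℝ → ℝ≥0∞} (hW : Measurable fun q : ℝ × ℝ => W q.1 q.2)
    (hp : ∀ s, Function.Periodic (fun x => W x s) (2 * π)) :
    ∫⁻ x in Ioc 0 (2 * π), ∫⁻ s in Ioc (-π) π, W (x + s) s =
      ∫⁻ x in Ioc 0 (2 * π), ∫⁻ s in Ioc (-π) π, W x s := by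
  have e1 := lintegral_lintegral_swap (μ := volume.restrict (Ioc 0 (2 * π)))
    (ν := volume.restrict (Ioc (-π) π)) (f := fun x s => W (x + s) s)
    (hW.comp (f := fun q : ℝ × ℝ => (q.1 + q.2, q.2)) (by fun_prop)).aemeasurable
  have e2 := lintegral_lintegral_swap (μ := volume.restrict (Ioc 0 (2 * π)))
    (ν := volume.restrict (Ioc (-π) π)) (f := W) hW.aemeasurable
  rw [e1, e2]
  refine lintegral_congr fun s => ?_
  have h := lintegral_Ioc_shift (hp s) 0 0 s
  rwa [zero_add] at h

lemma lintegral_arcMean_eq (p : ℝ) (f : ℂ → ℂ) :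
    ∫⁻ x in Ioc 0 (2 * π), ∫⁻ s in Ioc (-π) π,
      ENNReal.ofReal (|s| ^ (p - 2)) * arcMean p f x s =
    ∫⁻ x in Ioc 0 (2 * π), ∫⁻ s in Ioc (-π) π,
      ENNReal.ofReal (|s| ^ (p - 2)) * radialPow p f x (1 / 4 * |s|) := by
  have hw : Measurable fun q : ℝ × ℝ => ENNReal.ofReal (|q.2| ^ (p - 2)) :=
    (measurable_snd.norm.pow_const _).ennreal_ofReal
  have hR : Measurable fun q : (ℝ × ℝ) × ℝ => radialPow p f (q.1.1 + q.1.2 * q.2) (|q.1.2| / 4) := by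
    refine (measurable_radialPow p f).comp
      (f := fun q : (ℝ × ℝ) × ℝ => (q.1.1 + q.1.2 * q.2, |q.1.2| / 4)) ?_
    have h1 : Measurable fun q : (ℝ × ℝ) × ℝ => |q.1.2| / 4 :=
      (measurable_snd.comp measurable_fst).norm.div_const 4
    exact Measurable.prodMk (by fun_prop) h1
  have hA : Measurable fun q : ℝ × ℝ => arcMean p f q.1 q.2 := hR.lintegral_prod_right'
  have hR' : Measurable fun q : ℝ × ℝ => radialPow p f q.1 (1 / 4 * |q.2|) :=
    (measurable_radialPow p f).comp (f := fun q : ℝ × ℝ => (q.1, 1 / 4 * |q.2|))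
      (measurable_fst.prodMk (measurable_snd.norm.const_mul _))
  have e1 := lintegral_lintegral_swap (μ := volume.restrict (Ioc 0 (2 * π)))
    (ν := volume.restrict (Ioc (-π) π))
    (f := fun x s => ENNReal.ofReal (|s| ^ (p - 2)) * arcMean p f x s) (hw.mul hA).aemeasurable
  have e2 := lintegral_lintegral_swap (μ := volume.restrict (Ioc 0 (2 * π)))
    (ν := volume.restrict (Ioc (-π) π))
    (f := fun x s => ENNReal.ofReal (|s| ^ (p - 2)) * radialPow p f x (1 / 4 * |s|))
    (hw.mul hR').aemeasurable
  rw [e1, e2]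
  refine lintegral_congr fun s => ?_
  rw [lintegral_const_mul' _ _ ENNReal.ofReal_ne_top,
    lintegral_const_mul' _ _ ENNReal.ofReal_ne_top]
  congr 1
  simp only [arcMean]
  rw [lintegral_lintegral_swap]
  swap
  · exact (hR.comp (f := fun q : ℝ × ℝ => ((q.1, s), q.2)) (by fun_prop)).aemeasurable
  have h : ∀ v : ℝ, ∫⁻ x in Ioc 0 (2 * π), radialPow p f (x + s * v) (|s| / 4) =
      ∫⁻ x in Ioc 0 (2 * π), radialPow p f x (1 / 4 * |s|) := by
    intro v
    have h := lintegral_Ioc_shift (radialPow_periodic p f (|s| / 4)) 0 0 (s * v)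
    rw [zero_add] at h
    rw [h, show |s| / 4 = 1 / 4 * |s| by ring]
  simp_rw [h]
  simp

/-- The function `γ` is the radial boundary-value function of `f`. -/
def RadialLim (f γ : ℂ → ℂ) (ζ : ℂ) : Prop :=
  Tendsto (fun r : ℝ => f ((r : ℂ) * ζ)) (𝓝[<] 1) (𝓝 (γ ζ))

lemma exists_boundary_integrand_le {p : ℝ} (hp : 1 < p) : ∃ C : ℝ, 0 < C ∧ ∀ f γ : ℂ → ℂ,
    DifferentiableOn ℂ f unitDiskSet → ∀ x s : ℝ, s ∈ Ioc (-π) π → s ≠ 0 →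
    RadialLim f γ (circlePt x) → RadialLim f γ (circlePt (x + s)) →
    ENNReal.ofReal (‖γ (circlePt (x + s)) - γ (circlePt x)‖ ^ p / ‖circlePt s - 1‖ ^ (2 : ℕ)) ≤
      ENNReal.ofReal C * (ENNReal.ofReal (|s| ^ (p - 2)) *
        (radialMean p f (x + s) |s| + radialMean p f x |s| + arcMean p f x s)) := by
  obtain ⟨B, hB0, hB⟩ := exists_radialVar_rpow_le hp
  have hp0 : 0 < p := by linarith
  refine ⟨(π / 2) ^ 2 * (3 ^ p * (B + 1)), by positivity, fun f γ hf x s hs hs0 hx hxs => ?_⟩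
  have hpi := Real.pi_lt_d2
  have hs' : 0 < |s| := abs_pos.2 hs0
  have hsle : |s| ≤ π := abs_le.2 ⟨hs.1.le, hs.2⟩
  have hδ : |s| / 4 ∈ Ioo (0 : ℝ) 1 := ⟨by positivity, by linarith⟩
  have ha : ∀ y : ℝ, radialVar f y (|s| / 4) ^ p ≤
      ENNReal.ofReal ((B + 1) * |s| ^ p) * radialMean p f y |s| := by
    intro y
    refine (hB f y _ hδ.1.le).trans (mul_le_mul_left (ENNReal.ofReal_le_ofReal ?_) _)
    gcongr
    · linarith
    · linarith
  have hc : (∫⁻ v in Ioc (0 : ℝ) 1,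
      ENNReal.ofReal (radialDeriv f (x + s * v) (|s| / 4) * |s|)) ^ p ≤
      ENNReal.ofReal ((B + 1) * |s| ^ p) * arcMean p f x s := by
    refine (lintegral_rpow_le_lintegral_rpow hp ?_
      fun v => mul_nonneg (radialDeriv_nonneg _ _ _) (abs_nonneg s)).trans ?_
    · exact Measurable.mul_const ((measurable_radialDeriv f).comp
        (f := fun v : ℝ => (x + s * v, |s| / 4)) (by fun_prop)) _
    · rw [arcMean, ← lintegral_const_mul' _ _ ENNReal.ofReal_ne_top]
      refine lintegral_mono fun v => ?_
      have h0 := radialDeriv_nonneg f (x + s * v) (|s| / 4)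
      rw [radialPow, ← ENNReal.ofReal_mul (by positivity), Real.mul_rpow h0 hs'.le, mul_comm]
      refine ENNReal.ofReal_le_ofReal ?_
      gcongr
      exact le_mul_of_one_le_left (by positivity) (by linarith)
  have htri : ‖γ (circlePt (x + s)) - γ (circlePt x)‖ₑ ≤ radialVar f (x + s) (|s| / 4) +
      radialVar f x (|s| / 4) + ∫⁻ v in Ioc (0 : ℝ) 1,
        ENNReal.ofReal (radialDeriv f (x + s * v) (|s| / 4) * |s|) := by
    have h1 := enorm_boundary_sub_le hf hx hδ
    have h2 := enorm_boundary_sub_le hf hxs hδ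
    have h3 := enorm_arc_sub_le hf x s hδ
    rw [enorm_sub_rev] at h1
    refine le_trans ?_ (add_le_add (add_le_add h2 h1) h3)
    set P := f (((1 - |s| / 4 : ℝ) : ℂ) * circlePt (x + s))
    set Q := f (((1 - |s| / 4 : ℝ) : ℂ) * circlePt x)
    rw [show γ (circlePt (x + s)) - γ (circlePt x) =
      (γ (circlePt (x + s)) - P) + (Q - γ (circlePt x)) + (P - Q) by ring]
    exact (enorm_add_le _ _).trans (add_le_add_left (enorm_add_le _ _) _)
  have hmain : ENNReal.ofReal (‖γ (circlePt (x + s)) - γ (circlePt x)‖ ^ p) ≤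
      ENNReal.ofReal (3 ^ p * ((B + 1) * |s| ^ p)) *
        (radialMean p f (x + s) |s| + radialMean p f x |s| + arcMean p f x s) := by
    rw [← ENNReal.ofReal_rpow_of_nonneg (norm_nonneg _) hp0.le, ofReal_norm]
    refine (ENNReal.rpow_le_rpow htri hp0.le).trans ((add_three_rpow_le hp0.le _ _ _).trans ?_)
    rw [ENNReal.ofReal_mul (by positivity), ← ENNReal.ofReal_rpow_of_nonneg (by norm_num) hp0.le,
      ENNReal.ofReal_ofNat, mul_assoc]
    refine mul_le_mul_right ?_ _
    rw [mul_add, mul_add]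
    exact add_le_add (add_le_add (ha _) (ha _)) hc
  have hcp := pos_norm_circlePt_sub_one hs hs0
  rw [div_eq_mul_inv, ENNReal.ofReal_mul (by positivity)]
  have hd : ENNReal.ofReal ((‖circlePt s - 1‖ ^ 2)⁻¹) ≤
      ENNReal.ofReal ((π / 2) ^ 2 * (|s| ^ 2)⁻¹) := by
    refine ENNReal.ofReal_le_ofReal ?_
    have h := le_norm_circlePt_sub_one hsle
    rw [inv_le_comm₀ (by positivity) (by positivity), mul_inv, inv_inv, ← inv_pow, inv_div,
      ← mul_pow]
    gcongr
  refine (mul_le_mul' hmain hd).trans_eq ?_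
  rw [mul_comm, ← mul_assoc, ← ENNReal.ofReal_mul (by positivity),
    ← mul_assoc (ENNReal.ofReal _) (ENNReal.ofReal _), ← ENNReal.ofReal_mul (by positivity)]
  congr 2
  rw [Real.rpow_sub hs', Real.rpow_two]
  field_simp

lemma exists_besovEnergy_boundary_le {p : ℝ} (hp : 1 < p) : ∃ C : ℝ, 0 < C ∧ ∀ f γ : ℂ → ℂ,
    DifferentiableOn ℂ f unitDiskSet → CircleAE (RadialLim f γ) →
      besovEnergy p γ ≤ ENNReal.ofReal C * analyticBesovEnergy p f := by
  obtain ⟨K, hK0, hK⟩ := exists_boundary_integrand_le hp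
  refine ⟨K * ((10 * 4 ^ (p - 1)) * (5 * 2 ^ |p - 2|)), by positivity, fun f γ hf hγ => ?_⟩
  set w : ℝ → ℝ≥0∞ := fun s => ENNReal.ofReal (|s| ^ (p - 2)) with hw
  have hwm : Measurable w := (measurable_norm.pow_const _).ennreal_ofReal
  have hwm2 : Measurable fun q : ℝ × ℝ => w q.2 := hwm.comp measurable_snd
  set Q : ℝ → ℝ → ℝ≥0∞ := fun x s => w s * radialMean p f x |s| with hQ
  have hQm : Measurable fun q : ℝ × ℝ => Q q.1 q.2 :=
    hwm2.mul ((measurable_radialMean p f).comp (f := fun q : ℝ × ℝ => (q.1, |q.2|))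
      (measurable_fst.prodMk measurable_snd.norm))
  have hae := CircleAE.ae hγ
  set E : ℝ≥0∞ := ∫⁻ x in Ioc 0 (2 * π), ∫⁻ τ in Ioo (0 : ℝ) (4 / 5), radialEnergy p f x τ with hE
  have hQE : ∫⁻ x in Ioc 0 (2 * π), ∫⁻ s in Ioc (-π) π, Q x s ≤
      ENNReal.ofReal (4 * 4 ^ (p - 1)) * E := by
    rw [hE, ← lintegral_const_mul' _ _ ENNReal.ofReal_ne_top]
    exact lintegral_mono fun x => lintegral_radialMean_le f x
  have hQE' : ∫⁻ x in Ioc 0 (2 * π), ∫⁻ s in Ioc (-π) π, Q (x + s) s ≤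
      ENNReal.ofReal (4 * 4 ^ (p - 1)) * E := by
    rw [lintegral_swap_shift hQm]
    · exact hQE
    · intro s x
      exact congrArg (w s * ·) (radialMean_periodic p f |s| x)
  have hRE : ∫⁻ x in Ioc 0 (2 * π), ∫⁻ s in Ioc (-π) π, w s * arcMean p f x s ≤
      ENNReal.ofReal (2 * 4 ^ (p - 1)) * E := by
    rw [hw, lintegral_arcMean_eq, hE, ← lintegral_const_mul' _ _ ENNReal.ofReal_ne_top]
    refine lintegral_mono fun x => (lintegral_abs_rpow_mul_radialPow_le p f x (by norm_num)
      le_rfl).trans_eq ?_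
    rw [one_div, Real.inv_rpow (by norm_num), ← Real.rpow_neg (by norm_num), neg_sub]
  calc besovEnergy p γ ≤ ∫⁻ x in Ioc 0 (2 * π), ∫⁻ s in Ioc (-π) π,
        ENNReal.ofReal K * (Q (x + s) s + Q x s + w s * arcMean p f x s) := by
        rw [besovEnergy_eq]
        refine lintegral_mono_ae (ae_restrict_of_ae ?_)
        filter_upwards [hae] with x hx
        have hae' : ∀ᵐ s : ℝ, RadialLim f γ (circlePt (x + s)) :=
          (measurePreserving_add_left volume x).quasiMeasurePreserving.ae hae
        have hne : ∀ᵐ s : ℝ, s ≠ 0 := by simp [ae_iff]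
        refine lintegral_mono_ae ?_
        filter_upwards [ae_restrict_of_ae hae', ae_restrict_of_ae hne,
          ae_restrict_mem measurableSet_Ioc] with s h1 h2 h3
        refine (hK f γ hf x s h3 h2 hx h1).trans_eq ?_
        simp only [hQ, hw, mul_add]
    _ = ENNReal.ofReal K * ((∫⁻ x in Ioc 0 (2 * π), ∫⁻ s in Ioc (-π) π, Q (x + s) s) +
        (∫⁻ x in Ioc 0 (2 * π), ∫⁻ s in Ioc (-π) π, Q x s) +
        ∫⁻ x in Ioc 0 (2 * π), ∫⁻ s in Ioc (-π) π, w s * arcMean p f x s) := by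
        have hQs : Measurable fun q : ℝ × ℝ => Q (q.1 + q.2) q.2 :=
          hQm.comp (f := fun q : ℝ × ℝ => (q.1 + q.2, q.2)) (by fun_prop)
        rw [← lintegral_add_left (hQs.lintegral_prod_right'),
          ← lintegral_add_left, ← lintegral_const_mul' _ _ ENNReal.ofReal_ne_top]
        · refine lintegral_congr fun x => ?_
          have m1 : Measurable fun s => Q (x + s) s :=
            hQs.comp (f := fun s : ℝ => (x, s)) (by fun_prop)
          have m2 : Measurable fun s => Q x s :=
            hQm.comp (f := fun s : ℝ => (x, s)) (by fun_prop)
          rw [lintegral_const_mul' _ _ ENNReal.ofReal_ne_top,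
            lintegral_add_left (f := fun s => Q (x + s) s + Q x s) (m1.add m2),
            lintegral_add_left m1]
        · exact (hQs.lintegral_prod_right').add hQm.lintegral_prod_right'
    _ ≤ ENNReal.ofReal K * (ENNReal.ofReal (4 * 4 ^ (p - 1)) * E +
        ENNReal.ofReal (4 * 4 ^ (p - 1)) * E + ENNReal.ofReal (2 * 4 ^ (p - 1)) * E) := by
        gcongr
    _ = ENNReal.ofReal (K * (10 * 4 ^ (p - 1))) * E := by
        rw [← add_mul, ← add_mul, ← ENNReal.ofReal_add (by positivity) (by positivity),
          ← ENNReal.ofReal_add (by positivity) (by positivity), ← mul_assoc,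
          ← ENNReal.ofReal_mul hK0.le]
        congr 2
        ring
    _ ≤ _ := by
        refine (mul_le_mul_right (lintegral_radialEnergy_le p f) _).trans_eq ?_
        rw [← mul_assoc, ← ENNReal.ofReal_mul (by positivity), mul_assoc K]

/-- A majorant of `|f|` on the outer half of the radius of angle `x`. -/
def radialBound (f : ℂ → ℂ) (x : ℝ) : ℝ≥0∞ :=
  ‖f (((1 - 1 / 2 : ℝ) : ℂ) * circlePt x)‖ₑ + radialVar f x (1 / 2)

lemma continuous_comp_mul_circlePt {f : ℂ → ℂ} (hf : DifferentiableOn ℂ f unitDiskSet) {r : ℝ}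
    (h0 : 0 < r) (h1 : r < 1) : Continuous fun x : ℝ => f ((r : ℂ) * circlePt x) := by
  refine hf.continuousOn.comp_continuous (by have := continuous_circlePt; fun_prop) fun x => ?_
  have h := mul_circlePt_mem_disk x (δ := 1 - r) (by linarith) (by linarith)
  rwa [sub_sub_cancel] at h

lemma measurable_radialBound {f : ℂ → ℂ} (hf : DifferentiableOn ℂ f unitDiskSet) :
    Measurable (radialBound f) := by
  refine Measurable.add (continuous_comp_mul_circlePt hf (by norm_num) (by norm_num)).enorm.measurable
    ?_
  refine Measurable.lintegral_prod_right'
    (f := fun q : ℝ × ℝ => ENNReal.ofReal (radialDeriv f q.1 (1 / 2 * q.2) * (1 / 2))) ?_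
  exact (((measurable_radialDeriv f).comp (f := fun q : ℝ × ℝ => (q.1, 1 / 2 * q.2))
    (by fun_prop)).mul_const _).ennreal_ofReal

lemma enorm_le_radialBound {f : ℂ → ℂ} (hf : DifferentiableOn ℂ f unitDiskSet) (x : ℝ) {r : ℝ}
    (hr : r ∈ Ico (1 / 2 : ℝ) 1) : ‖f ((r : ℂ) * circlePt x)‖ₑ ≤ radialBound f x := by
  have h := enorm_radial_sub_le hf x (δ := 1 / 2) (η := 2 * (1 - r)) ⟨by norm_num, by norm_num⟩
    ⟨by linarith [hr.2], by linarith [hr.1]⟩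
  rw [show 1 - 1 / 2 * (2 * (1 - r)) = r by ring] at h
  calc ‖f ((r : ℂ) * circlePt x)‖ₑ = ‖f (((1 - 1 / 2 : ℝ) : ℂ) * circlePt x) +
        (f ((r : ℂ) * circlePt x) - f (((1 - 1 / 2 : ℝ) : ℂ) * circlePt x))‖ₑ := by
        rw [add_sub_cancel]
    _ ≤ _ := (enorm_add_le _ _).trans (add_le_add_right h _)

lemma lintegral_radialBound_lt_top {p : ℝ} (hp : 1 < p) {f : ℂ → ℂ} (hf : MemAnalyticBesov p f) :
    ∫⁻ x in Ioc 0 (2 * π), radialBound f x < ⊤ := by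
  obtain ⟨C, hC0, hC⟩ := exists_radialVar_rpow_le hp
  have hp0 : 0 < p := by linarith
  have hfin : ∫⁻ x in Ioc 0 (2 * π), ∫⁻ τ in Ioo (0 : ℝ) (4 / 5), radialEnergy p f x τ < ⊤ :=
    (lintegral_radialEnergy_le p f).trans_lt (ENNReal.mul_lt_top ENNReal.ofReal_lt_top hf.2)
  have hcont := continuous_comp_mul_circlePt hf.1 (r := 1 - 1 / 2) (by norm_num) (by norm_num)
  have h1 : ∫⁻ x in Ioc 0 (2 * π), ‖f (((1 - 1 / 2 : ℝ) : ℂ) * circlePt x)‖ₑ < ⊤ :=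
    (hcont.integrableOn_Ioc (μ := volume)).2
  have hV : ∀ x, radialVar f x (1 / 2) ≤ 1 + ENNReal.ofReal (C * (1 / 2) ^ p) *
      (ENNReal.ofReal ((1 / 2) ^ (-(p - 2) - 1)) *
        ∫⁻ τ in Ioo (0 : ℝ) (4 / 5), radialEnergy p f x τ) := by
    intro x
    have h2 : radialVar f x (1 / 2) ≤ 1 + radialVar f x (1 / 2) ^ p := by
      rcases le_total (radialVar f x (1 / 2)) 1 with h | h
      · exact h.trans le_self_add
      · exact (ENNReal.le_rpow_self_of_one_le h hp.le).trans le_add_self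
    refine h2.trans (add_le_add_right ((hC f x _ (by norm_num)).trans (mul_le_mul_right ?_ _)) _)
    have h3 := lintegral_Ioc_comp_mul_le (p - 2) (radialPow p f x) (k := 1 / 2) (b := 1)
      (by norm_num) (by norm_num)
    refine (setLIntegral_mono' measurableSet_Ioc fun v hv => ?_).trans (h3.trans_eq ?_)
    · refine mul_le_mul_left (ENNReal.ofReal_le_ofReal ?_) _
      exact Real.rpow_le_rpow_of_exponent_ge hv.1 hv.2 (by linarith)
    · congr 1
      exact setLIntegral_congr_fun measurableSet_Ioo fun τ hτ => (radialEnergy_eq p f x hτ.1).symm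
  have h4 : ∫⁻ x in Ioc 0 (2 * π), radialVar f x (1 / 2) < ⊤ := by
    refine (lintegral_mono hV).trans_lt ?_
    rw [lintegral_add_left measurable_const, lintegral_const_mul' _ _ ENNReal.ofReal_ne_top,
      lintegral_const_mul' _ _ ENNReal.ofReal_ne_top]
    refine ENNReal.add_lt_top.2 ⟨by rw [setLIntegral_one]; exact measure_Ioc_lt_top,
      ENNReal.mul_lt_top ENNReal.ofReal_lt_top
      (ENNReal.mul_lt_top ENNReal.ofReal_lt_top hfin)⟩
  simp only [radialBound]
  rw [lintegral_add_left hcont.enorm.measurable]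
  exact ENNReal.add_lt_top.2 ⟨h1, h4⟩

lemma integrableOn_boundary {p : ℝ} (hp : 1 < p) {f γ : ℂ → ℂ} (hf : MemAnalyticBesov p f)
    (hγ : CircleAE (RadialLim f γ)) :
    IntegrableOn (fun θ : ℝ => γ (circlePt θ)) (Ioc 0 (2 * π)) := by
  have hmem : ∀ᶠ r : ℝ in 𝓝[<] 1, r ∈ Ico (1 / 2 : ℝ) 1 := by
    filter_upwards [Ioo_mem_nhdsLT (show (1 / 2 : ℝ) < 1 by norm_num)] with r hr
    exact ⟨hr.1.le, hr.2⟩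
  constructor
  · obtain ⟨u, hu⟩ := exists_seq_tendsto (𝓝[<] (1 : ℝ))
    obtain ⟨N, hN⟩ := eventually_atTop.1 (hu.eventually hmem)
    refine aestronglyMeasurable_of_tendsto_ae atTop
      (f := fun n θ => f ((u (n + N) : ℝ) * circlePt θ)) (fun n => ?_) ?_
    · have h := hN (n + N) (Nat.le_add_left _ _)
      exact (continuous_comp_mul_circlePt hf.1 (by linarith [h.1]) h.2).aestronglyMeasurable
    · filter_upwards [hγ] with θ hθ
      exact (hθ.comp hu).comp (tendsto_add_atTop_nat N)
  · refine lt_of_le_of_lt (lintegral_mono_ae ?_) (lintegral_radialBound_lt_top hp hf)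
    filter_upwards [hγ] with θ hθ
    refine le_of_tendsto hθ.enorm ?_
    filter_upwards [hmem] with r hr
    exact enorm_le_radialBound hf.1 θ hr

lemma szego_dilate {f : ℂ → ℂ} (hf : DifferentiableOn ℂ f unitDiskSet) {r : ℝ} (h0 : 0 < r)
    (h1 : r < 1) {z : ℂ} (hz : z ∈ unitDiskSet) :
    szego (fun w => f ((r : ℂ) * w)) z = f ((r : ℂ) * z) := by
  have hmaps : ∀ w ∈ closedBall (0 : ℂ) 1, (r : ℂ) * w ∈ unitDiskSet := by
    intro w hw
    rw [mem_closedBall_zero_iff] at hw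
    rw [unitDiskSet, mem_ball_zero_iff, norm_mul, Complex.norm_real, Real.norm_of_nonneg h0.le]
    nlinarith [norm_nonneg w]
  have hd : DifferentiableOn ℂ (fun w => f ((r : ℂ) * w)) (closedBall (0 : ℂ) 1) :=
    hf.comp (by fun_prop) hmaps
  have hcl : DiffContOnCl ℂ (fun w => f ((r : ℂ) * w)) (ball (0 : ℂ) 1) := by
    refine DifferentiableOn.diffContOnCl ?_
    rwa [closure_ball _ one_ne_zero]
  have h := hcl.circleIntegral_sub_inv_smul hz
  rw [circleIntegral, intervalIntegral.integral_of_le Real.two_pi_pos.le] at h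
  have h2 : ∫ t in Ioc (0 : ℝ) (2 * π),
      f ((r : ℂ) * circlePt t) / (circlePt t - z) * (Complex.I * circlePt t) =
      (2 * π * Complex.I) • f ((r : ℂ) * z) := by
    rw [← h]
    refine integral_congr_ae (Eventually.of_forall fun t => ?_)
    simp only [deriv_circleMap, ← circlePt_eq_circleMap, smul_eq_mul]
    ring
  rw [szego, h2, smul_eq_mul, inv_mul_cancel_left₀ Complex.two_pi_I_ne_zero]

lemma szego_boundary {p : ℝ} (hp : 1 < p) {f γ : ℂ → ℂ} (hf : MemAnalyticBesov p f)
    (hγ : CircleAE (RadialLim f γ)) {z : ℂ} (hz : z ∈ unitDiskSet) : szego γ z = f z := by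
  have hz1 : ‖z‖ < 1 := mem_ball_zero_iff.1 hz
  have hmem : ∀ᶠ r : ℝ in 𝓝[<] 1, r ∈ Ico (1 / 2 : ℝ) 1 := by
    filter_upwards [Ioo_mem_nhdsLT (show (1 / 2 : ℝ) < 1 by norm_num)] with r hr
    exact ⟨hr.1.le, hr.2⟩
  have hmeas := measurable_radialBound hf.1
  have hfin := lintegral_radialBound_lt_top hp hf
  have hb : Integrable (fun x => (radialBound f x).toReal * (1 - ‖z‖)⁻¹)
      (volume.restrict (Ioc 0 (2 * π))) :=
    (integrable_toReal_of_lintegral_ne_top hmeas.aemeasurable hfin.ne).mul_const _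
  have hne : ∀ t, circlePt t - z ≠ 0 := fun t => circlePt_sub_ne_of_mem_disk hz t
  have hlim : Tendsto (fun r : ℝ => ∫ t in Ioc (0 : ℝ) (2 * π),
      f ((r : ℂ) * circlePt t) / (circlePt t - z) * (Complex.I * circlePt t)) (𝓝[<] 1)
      (𝓝 (∫ t in Ioc (0 : ℝ) (2 * π),
        γ (circlePt t) / (circlePt t - z) * (Complex.I * circlePt t))) := by
    refine tendsto_integral_filter_of_dominated_convergence _ ?_ ?_ hb ?_
    · filter_upwards [hmem] with r hr
      refine Continuous.aestronglyMeasurable ?_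
      have h1 := continuous_comp_mul_circlePt hf.1 (r := r) (by linarith [hr.1]) hr.2
      have h2 := continuous_circlePt
      exact (h1.div (by fun_prop) hne).mul (by fun_prop)
    · filter_upwards [hmem] with r hr
      filter_upwards [ae_lt_top hmeas hfin.ne] with t ht
      have h1 : ‖f ((r : ℂ) * circlePt t)‖ ≤ (radialBound f t).toReal := by
        rw [← toReal_enorm]
        exact ENNReal.toReal_mono ht.ne (enorm_le_radialBound hf.1 t hr)
      have h2 : 1 - ‖z‖ ≤ ‖circlePt t - z‖ := by
        have h := norm_sub_norm_le (circlePt t) z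
        rwa [norm_circlePt] at h
      rw [norm_mul, norm_div, norm_mul, Complex.norm_I, norm_circlePt, mul_one, mul_one,
        div_eq_mul_inv]
      exact mul_le_mul h1 (inv_anti₀ (by linarith) h2) (by positivity) ENNReal.toReal_nonneg
    · filter_upwards [hγ] with t ht
      exact (ht.div_const _).mul_const _
  have hlim' : Tendsto (fun r : ℝ => f ((r : ℂ) * z)) (𝓝[<] 1) (𝓝 (szego γ z)) := by
    refine (hlim.const_mul (2 * π * Complex.I)⁻¹).congr' ?_
    filter_upwards [hmem] with r hr
    exact szego_dilate hf.1 (by linarith [hr.1]) hr.2 hz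
  have hcont : ContinuousAt f z := (hf.1.differentiableAt (isOpen_ball.mem_nhds hz)).continuousAt
  have hlim2 : Tendsto (fun r : ℝ => f ((r : ℂ) * z)) (𝓝[<] 1) (𝓝 (f z)) := by
    refine hcont.tendsto.comp ?_
    have h : Continuous fun r : ℝ => (r : ℂ) * z := by fun_prop
    have h1 := h.tendsto 1
    rw [Complex.ofReal_one, one_mul] at h1
    exact h1.mono_left nhdsWithin_le_nhds
  exact tendsto_nhds_unique hlim' hlim2

/-! ### Almost everywhere on the circle -/

lemma lipschitzWith_circlePt : LipschitzWith 1 circlePt :=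
  LipschitzWith.of_dist_le_mul fun a b => by
    rw [NNReal.coe_one, one_mul, dist_eq_norm, norm_circlePt_sub, Real.dist_eq]
    exact norm_circlePt_sub_one_le _

lemma CircleAE.ae_hausdorffMeasure {P : ℂ → Prop} (h : CircleAE P) :
    ∀ᵐ ζ ∂(μH[1] : Measure ℂ).restrict unitCircleSet, P ζ := by
  have hmeas : MeasurableSet unitCircleSet := isClosed_sphere.measurableSet
  rw [ae_restrict_iff' hmeas, ae_iff]
  rw [CircleAE, ae_restrict_iff' measurableSet_Ioc, ae_iff] at h
  set N := {θ : ℝ | ¬(θ ∈ Ioc 0 (2 * π) → P (circlePt θ))}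
  have hN : (μH[1] : Measure ℝ) N = 0 := by rwa [hausdorffMeasure_real]
  have himg := lipschitzWith_circlePt.hausdorffMeasure_image_le zero_le_one N
  rw [hN, mul_zero] at himg
  refine measure_mono_null ?_ (le_antisymm himg bot_le)
  intro ζ hζ
  simp only [mem_ofPred_eq, Classical.not_imp] at hζ
  obtain ⟨θ, hθ, rfl⟩ := exists_mem_circlePt_eq hζ.1 0
  rw [zero_add] at hθ
  exact ⟨θ, fun h => hζ.2 (h hθ), rfl⟩

lemma dist_le_dist_circlePt {a b : ℝ} (h : |a - b| ≤ π) :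
    dist a b ≤ π / 2 * dist (circlePt a) (circlePt b) := by
  have h1 := le_norm_circlePt_sub_one h
  rw [dist_eq_norm (circlePt a), norm_circlePt_sub, Real.dist_eq]
  calc |a - b| = π / 2 * (2 / π * |a - b|) := by field_simp
    _ ≤ _ := by gcongr

lemma volume_inter_preimage_circlePt_eq_zero {N : Set ℂ} (hN : (μH[1] : Measure ℂ) N = 0) (a : ℝ) :
    volume (Ioc a (a + π) ∩ circlePt ⁻¹' N) = 0 := by
  have habs : ∀ x ∈ Ioc a (a + π), ∀ y ∈ Ioc a (a + π), |x - y| ≤ π := fun x hx y hy =>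
    abs_le.2 ⟨by linarith [hx.1, hy.2], by linarith [hx.2, hy.1]⟩
  have hinj : InjOn circlePt (Ioc a (a + π)) := fun x hx y hy hxy => by
    have h := dist_le_dist_circlePt (habs x hx y hy)
    rw [hxy, dist_self, mul_zero] at h
    exact dist_le_zero.1 h
  set g := Function.invFunOn circlePt (Ioc a (a + π))
  have hg : LeftInvOn g circlePt (Ioc a (a + π)) := hinj.leftInvOn_invFunOn
  have hlip : LipschitzOnWith (π / 2).toNNReal g (circlePt '' Ioc a (a + π)) := by
    refine LipschitzOnWith.of_dist_le_mul ?_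
    rintro _ ⟨x, hx, rfl⟩ _ ⟨y, hy, rfl⟩
    rw [hg hx, hg hy, Real.coe_toNNReal _ (by positivity)]
    exact dist_le_dist_circlePt (habs x hx y hy)
  have h0 : (μH[1] : Measure ℂ) (N ∩ circlePt '' Ioc a (a + π)) = 0 :=
    measure_mono_null inter_subset_left hN
  have himg := (hlip.mono inter_subset_right).hausdorffMeasure_image_le zero_le_one
    (s := N ∩ circlePt '' Ioc a (a + π))
  rw [h0, mul_zero, hausdorffMeasure_real] at himg
  refine measure_mono_null ?_ (le_antisymm himg bot_le)
  rintro θ ⟨hθ, hθN⟩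
  exact ⟨circlePt θ, ⟨hθN, θ, hθ, rfl⟩, hg hθ⟩

lemma circleAE_of_ae_hausdorffMeasure {P : ℂ → Prop}
    (h : ∀ᵐ ζ ∂(μH[1] : Measure ℂ).restrict unitCircleSet, P ζ) : CircleAE P := by
  have hmeas : MeasurableSet unitCircleSet := isClosed_sphere.measurableSet
  rw [ae_restrict_iff' hmeas, ae_iff] at h
  rw [CircleAE, ae_restrict_iff' measurableSet_Ioc, ae_iff]
  refine measure_mono_null ?_ (measure_union_null
    (volume_inter_preimage_circlePt_eq_zero h 0) (volume_inter_preimage_circlePt_eq_zero h π))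
  intro θ hθ
  simp only [mem_ofPred_eq, Classical.not_imp] at hθ
  have hmem : θ ∈ circlePt ⁻¹' {ζ | ¬(ζ ∈ unitCircleSet → P ζ)} := by
    simpa using ⟨circlePt_mem θ, hθ.2⟩
  rcases le_or_gt θ π with h1 | h1
  · exact Or.inl ⟨⟨hθ.1.1, by linarith⟩, hmem⟩
  · exact Or.inr ⟨⟨h1, by linarith [hθ.1.2]⟩, hmem⟩

lemma HasNTLimAt.radialLim {f γ : ℂ → ℂ} {ζ : ℂ} (hζ : ζ ∈ unitCircleSet)
    (h : HasNTLimAt f unitDiskSet (γ ζ) ζ) : RadialLim f γ ζ := by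
  have hζ1 : ‖ζ‖ = 1 := mem_sphere_zero_iff_norm.1 hζ
  refine (h 2 one_lt_two).comp (tendsto_nhdsWithin_iff.2 ⟨?_, ?_⟩)
  · have hc : Continuous fun r : ℝ => (r : ℂ) * ζ := by fun_prop
    have h1 := hc.tendsto 1
    rw [Complex.ofReal_one, one_mul] at h1
    exact h1.mono_left nhdsWithin_le_nhds
  · filter_upwards [Ioo_mem_nhdsLT (zero_lt_one (α := ℝ))] with r hr
    have hnorm : ‖(r : ℂ) * ζ‖ = r := by
      rw [norm_mul, hζ1, mul_one, Complex.norm_real, Real.norm_of_nonneg hr.1.le]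
    have hfr : frontier unitDiskSet = sphere (0 : ℂ) 1 := frontier_ball _ one_ne_zero
    refine ⟨by rw [unitDiskSet, mem_ball_zero_iff, hnorm]; exact hr.2, ?_⟩
    have h1 : ‖(r : ℂ) * ζ - ζ‖ = 1 - r := by
      rw [show (r : ℂ) * ζ - ζ = ((r - 1 : ℝ) : ℂ) * ζ by push_cast; ring, norm_mul, hζ1, mul_one,
        Complex.norm_real, Real.norm_eq_abs, abs_of_neg (by linarith [hr.2]), neg_sub]
    have h2 : 1 - r ≤ infDist ((r : ℂ) * ζ) (frontier unitDiskSet) := by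
      rw [hfr, le_infDist (s := sphere (0 : ℂ) 1) ⟨ζ, hζ⟩]
      intro y hy
      have h3 := norm_sub_norm_le y ((r : ℂ) * ζ)
      rw [hnorm, mem_sphere_zero_iff_norm.1 hy] at h3
      rwa [dist_comm, dist_eq_norm]
    rw [h1]
    linarith [hr.2]

/-! ### The Hilbert transform and the Szegő projection -/

lemma IsHilbertTransformOf.circleAE_eq_hilb {p : ℝ} (hp : 1 < p) {φ ψ : ℂ → ℂ}
    (hφ : MemBesov p φ) (hψ : IsHilbertTransformOf ψ φ) : CircleAE fun ζ => ψ ζ = hilb φ ζ := by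
  filter_upwards [hφ.diniAt hp, hψ] with θ h1 h2
  exact tendsto_nhds_unique h2 h1.tendsto_hilbertTrunc

lemma IsHilbertTransformOf.hasNTLimAt_szego {p : ℝ} (hp : 1 < p) {φ ψ : ℂ → ℂ}
    (hφ : MemBesov p φ) (hψ : IsHilbertTransformOf ψ φ) :
    CircleAE fun ζ => HasNTLimAt (szego φ) unitDiskSet ((φ ζ + ψ ζ) / 2) ζ := by
  filter_upwards [hφ.diniAt hp, hψ.circleAE_eq_hilb hp hφ] with θ h1 h2
  rw [h2]
  exact h1.hasNTLimAt_szego hφ.1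

lemma IsHilbertTransformOf.radialLim_szego {p : ℝ} (hp : 1 < p) {φ ψ : ℂ → ℂ}
    (hφ : MemBesov p φ) (hψ : IsHilbertTransformOf ψ φ) :
    CircleAE (RadialLim (szego φ) fun ζ => (φ ζ + ψ ζ) / 2) := by
  filter_upwards [hψ.hasNTLimAt_szego hp hφ] with θ h
  exact HasNTLimAt.radialLim (γ := fun ζ => (φ ζ + ψ ζ) / 2) (circlePt_mem θ) h

lemma MemBesov.memAnalyticBesov_szego {p : ℝ} (hp : 1 < p) {φ : ℂ → ℂ} (hφ : MemBesov p φ) :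
    MemAnalyticBesov p (szego φ) := by
  obtain ⟨C, -, hC⟩ := exists_analyticBesovEnergy_szego_le hp
  exact ⟨fun z hz => (hasDerivAt_szego hφ.1 hz).differentiableAt.differentiableWithinAt,
    (hC φ hφ).trans_lt (ENNReal.mul_lt_top ENNReal.ofReal_lt_top hφ.2)⟩

lemma besovEnergy_two_mul_sub_le {p : ℝ} (hp : 0 ≤ p) {φ : ℂ → ℂ} (hφ : MemBesov p φ)
    (g : ℂ → ℂ) : besovEnergy p (fun ζ => 2 * g ζ - φ ζ) ≤
      ENNReal.ofReal (2 ^ p) * besovEnergy p φ + ENNReal.ofReal (4 ^ p) * besovEnergy p g := by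
  obtain ⟨φ', hm, hφ'⟩ := exists_measurable_circleAE_eq hφ.1.aestronglyMeasurable
  have hcongr : CircleAE fun ζ => 2 * g ζ - φ ζ = 2 * g ζ - φ' ζ := by
    filter_upwards [hφ'] with θ h
    rw [h]
  rw [besovEnergy_congr p hcongr, ← besovEnergy_congr p hφ']
  have hF : Measurable fun q : ℝ × ℝ => ENNReal.ofReal
      (‖φ' (circlePt q.1) - φ' (circlePt q.2)‖ ^ p / ‖circlePt q.1 - circlePt q.2‖ ^ (2 : ℕ)) := by
    have hc := measurable_circlePt
    have h1 : Measurable fun q : ℝ × ℝ => φ' (circlePt q.1) - φ' (circlePt q.2) :=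
      (hm.comp (hc.comp measurable_fst)).sub (hm.comp (hc.comp measurable_snd))
    have h2 : Measurable fun q : ℝ × ℝ => circlePt q.1 - circlePt q.2 :=
      (hc.comp measurable_fst).sub (hc.comp measurable_snd)
    exact ((h1.norm.pow_const p).div (h2.norm.pow_const 2)).ennreal_ofReal
  have hpt : ∀ (a b : ℂ) (d : ℝ), 0 ≤ d → ENNReal.ofReal (‖2 * a - b‖ ^ p / d) ≤
      ENNReal.ofReal (2 ^ p) * ENNReal.ofReal (‖b‖ ^ p / d) +
        ENNReal.ofReal (4 ^ p) * ENNReal.ofReal (‖a‖ ^ p / d) := by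
    intro a b d hd
    rw [← ENNReal.ofReal_mul (by positivity), ← ENNReal.ofReal_mul (by positivity),
      ← ENNReal.ofReal_add (by positivity) (by positivity), ← mul_div_assoc, ← mul_div_assoc,
      ← add_div, ← Real.mul_rpow zero_le_two (norm_nonneg b),
      ← Real.mul_rpow (by norm_num) (norm_nonneg a)]
    refine ENNReal.ofReal_le_ofReal (div_le_div_of_nonneg_right ?_ hd)
    have h : ‖2 * a - b‖ ≤ 2 * ‖a‖ + ‖b‖ := by
      refine (norm_sub_le _ _).trans_eq ?_
      rw [norm_mul, Complex.norm_ofNat]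
    have ha : 0 ≤ (4 * ‖a‖) ^ p := by positivity
    have hb : 0 ≤ (2 * ‖b‖) ^ p := by positivity
    rcases le_total (2 * ‖a‖) ‖b‖ with hab | hab
    · have := Real.rpow_le_rpow (norm_nonneg _) (show ‖2 * a - b‖ ≤ 2 * ‖b‖ by linarith) hp
      linarith
    · have := Real.rpow_le_rpow (norm_nonneg _) (show ‖2 * a - b‖ ≤ 4 * ‖a‖ by linarith) hp
      linarith
  simp only [besovEnergy]
  rw [← lintegral_const_mul' _ _ ENNReal.ofReal_ne_top,
    ← lintegral_const_mul' _ _ ENNReal.ofReal_ne_top,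
    ← lintegral_add_left (hF.lintegral_prod_right'.const_mul _)]
  refine lintegral_mono fun x => ?_
  rw [← lintegral_const_mul' _ _ ENNReal.ofReal_ne_top,
    ← lintegral_const_mul' _ _ ENNReal.ofReal_ne_top,
    ← lintegral_add_left (f := fun y => ENNReal.ofReal (2 ^ p) * ENNReal.ofReal
      (‖φ' (circlePt x) - φ' (circlePt y)‖ ^ p / ‖circlePt x - circlePt y‖ ^ (2 : ℕ)))
      ((hF.comp (f := fun y : ℝ => (x, y)) (by fun_prop)).const_mul _)]
  refine lintegral_mono fun y => ?_
  have h := hpt (g (circlePt x) - g (circlePt y)) (φ' (circlePt x) - φ' (circlePt y))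
    (‖circlePt x - circlePt y‖ ^ 2) (by positivity)
  refine le_trans (le_of_eq ?_) h
  congr 4
  ring

lemma exists_besovEnergy_hilbert_le {p : ℝ} (hp : 1 < p) : ∃ K : ℝ, 0 < K ∧ ∀ φ ψ : ℂ → ℂ,
    MemBesov p φ → IsHilbertTransformOf ψ φ →
      MemBesov p ψ ∧ besovEnergy p ψ ≤ ENNReal.ofReal K * besovEnergy p φ := by
  obtain ⟨A, hA0, hA⟩ := exists_analyticBesovEnergy_szego_le hp
  obtain ⟨B, hB0, hB⟩ := exists_besovEnergy_boundary_le hp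
  refine ⟨2 ^ p + 4 ^ p * (B * A), by positivity, fun φ ψ hφ hψ => ?_⟩
  have hS := hφ.memAnalyticBesov_szego hp
  have hrad := hψ.radialLim_szego hp hφ
  have hψg : ψ = fun ζ => 2 * ((φ ζ + ψ ζ) / 2) - φ ζ := by
    funext ζ
    ring
  have hE : besovEnergy p ψ ≤ ENNReal.ofReal (2 ^ p + 4 ^ p * (B * A)) * besovEnergy p φ := by
    conv_lhs => rw [hψg]
    refine (besovEnergy_two_mul_sub_le (by linarith) hφ _).trans ?_
    rw [ENNReal.ofReal_add (by positivity) (by positivity), add_mul,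
      ENNReal.ofReal_mul (by positivity), ENNReal.ofReal_mul hB0.le, mul_assoc, mul_assoc]
    exact add_le_add_right (mul_le_mul_right ((hB _ _ hS.1 hrad).trans
      (mul_le_mul_right (hA φ hφ) _)) _) _
  refine ⟨⟨?_, hE.trans_lt (ENNReal.mul_lt_top ENNReal.ofReal_lt_top hφ.2)⟩, hE⟩
  rw [hψg]
  exact ((integrableOn_boundary hp hS hrad).const_mul 2).sub hφ.1

lemma IsHilbertTransformOf.circleAE_hilbert_hilbert {p : ℝ} (hp : 1 < p) {φ ψ χ : ℂ → ℂ}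
    (hφ : MemBesov p φ) (hψ : IsHilbertTransformOf ψ φ) (hχ : IsHilbertTransformOf χ ψ) :
    CircleAE fun ζ => χ ζ = φ ζ := by
  obtain ⟨K, -, hK⟩ := exists_besovEnergy_hilbert_le hp
  have hψB := (hK φ ψ hφ hψ).1
  have hS := hφ.memAnalyticBesov_szego hp
  have hrad := hψ.radialLim_szego hp hφ
  have heq : ∀ z ∈ unitDiskSet, szego φ z = szego ψ z := by
    intro z hz
    have h1 := szego_boundary hp hS hrad hz
    have h2 : (fun ζ => (φ ζ + ψ ζ) / 2) = fun ζ => 1 / 2 * (φ ζ + ψ ζ) := by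
      funext ζ
      ring
    rw [h2, szego_const_mul, szego_add hφ.1 hψB.1 hz] at h1
    linear_combination -2 * h1
  filter_upwards [hrad, hχ.radialLim_szego hp hψB] with θ h1 h2
  have h3 : RadialLim (szego ψ) (fun ζ => (φ ζ + ψ ζ) / 2) (circlePt θ) := by
    refine Tendsto.congr' ?_ h1
    filter_upwards [Ioo_mem_nhdsLT (zero_lt_one (α := ℝ))] with r hr
    have h := mul_circlePt_mem_disk θ (δ := 1 - r) (by linarith [hr.2]) (by linarith [hr.1])
    rw [sub_sub_cancel] at h
    exact heq _ h
  have h4 := tendsto_nhds_unique h3 h2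
  simp only at h4
  linear_combination -2 * h4

lemma IsNTBoundaryFun.circleAE_radialLim {f γ : ℂ → ℂ}
    (h : IsNTBoundaryFun f unitDiskSet unitCircleSet γ) : CircleAE (RadialLim f γ) := by
  filter_upwards [circleAE_of_ae_hausdorffMeasure h] with θ hθ
  exact HasNTLimAt.radialLim (circlePt_mem θ) hθ

lemma HasNTLimAt.congr {f g : ℂ → ℂ} {Ω : Set ℂ} {L ζ : ℂ} (h : HasNTLimAt f Ω L ζ)
    (hfg : EqOn f g Ω) : HasNTLimAt g Ω L ζ := fun M hM =>
  (h M hM).congr' (by filter_upwards [self_mem_nhdsWithin] with z hz using hfg hz.1)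

lemma rpow_one_div_le_of_le_ofReal_mul {p : ℝ} (hp : 0 < p) {K : ℝ} {a b : ℝ≥0∞}
    (h : a ≤ ENNReal.ofReal K * b) :
    a ^ (1 / p) ≤ ENNReal.ofReal K ^ (1 / p) * b ^ (1 / p) := by
  rw [← ENNReal.mul_rpow_of_nonneg _ _ (by positivity)]
  exact ENNReal.rpow_le_rpow h (by positivity)

/-- Let `p > 1`.
(1) The principal-value Hilbert transform `𝓗` maps `B_p(𝕊)` into itself and is a
Banach-space automorphism of `B_p(𝕊)` with `𝓗 ∘ 𝓗 = I` (modulo constants).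
(2) The Szegő projection `𝓢` is a bounded linear map from `B_p(𝕊)` into the
`p`-analytic Besov space `𝓑_p(𝔻)`, and `E ∘ 𝓢 = ½(I + 𝓗)` is a bounded projection
of `B_p(𝕊)` onto `E(𝓑_p(𝔻))`. -/
theorem statement15 (p : ℝ) (hp : 1 < p) :
    -- (1) the Hilbert transform exists on B_p(𝕊) ...
    ((∀ φ : ℂ → ℂ, MemBesov p φ → ∃ ψ : ℂ → ℂ, IsHilbertTransformOf ψ φ) ∧
      -- ... maps B_p into B_p, boundedly and with bounded inverse
      (∃ C : ℝ≥0∞, 0 < C ∧ C < ⊤ ∧ ∀ φ ψ : ℂ → ℂ, MemBesov p φ →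
        IsHilbertTransformOf ψ φ → MemBesov p ψ ∧
        besovNorm p ψ ≤ C * besovNorm p φ ∧ besovNorm p φ ≤ C * besovNorm p ψ) ∧
      -- ... and 𝓗 ∘ 𝓗 = I (modulo constants)
      (∀ φ ψ χ : ℂ → ℂ, MemBesov p φ → IsHilbertTransformOf ψ φ →
        IsHilbertTransformOf χ ψ → ∃ c : ℂ,
        ∀ᵐ θ ∂volume.restrict (Ioc (0 : ℝ) (2 * π)),
          χ (circlePt θ) = φ (circlePt θ) + c)) ∧
    -- (2) the Szegő projection maps B_p(𝕊) into 𝓑_p(𝔻) ...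
    ((∀ φ : ℂ → ℂ, MemBesov p φ → MemAnalyticBesov p (szego φ)) ∧
      -- ... boundedly
      (∃ C : ℝ≥0∞, 0 < C ∧ C < ⊤ ∧ ∀ φ : ℂ → ℂ, MemBesov p φ →
        analyticBesovNorm p (szego φ) ≤ C * besovNorm p φ) ∧
      -- ... with boundary values E ∘ 𝓢 = ½(I + 𝓗)
      (∀ φ ψ : ℂ → ℂ, MemBesov p φ → IsHilbertTransformOf ψ φ →
        IsNTBoundaryFun (szego φ) unitDiskSet unitCircleSet
          (fun ζ => (φ ζ + ψ ζ) / 2)) ∧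
      -- E ∘ 𝓢 restricts to the identity on E(𝓑_p(𝔻)) (modulo constants),
      -- so it is a projection onto E(𝓑_p(𝔻))
      (∀ f φf : ℂ → ℂ, MemAnalyticBesov p f →
        IsNTBoundaryFun f unitDiskSet unitCircleSet φf → MemBesov p φf →
        ∃ c : ℂ, IsNTBoundaryFun (szego φf) unitDiskSet unitCircleSet
          (fun ζ => φf ζ + c))) := by
  have hp0 : 0 < p := by linarith
  obtain ⟨K, hK0, hK⟩ := exists_besovEnergy_hilbert_le hp
  obtain ⟨A, hA0, hA⟩ := exists_analyticBesovEnergy_szego_le hp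
  have hpos : ∀ B : ℝ, 0 < B → 0 < ENNReal.ofReal B ^ (1 / p) := fun B hB =>
    ENNReal.rpow_pos (ENNReal.ofReal_pos.2 hB) ENNReal.ofReal_ne_top
  have hfin : ∀ B : ℝ, ENNReal.ofReal B ^ (1 / p) < ⊤ := fun B =>
    ENNReal.rpow_lt_top_of_nonneg (by positivity) ENNReal.ofReal_ne_top
  have hex : ∀ φ : ℂ → ℂ, MemBesov p φ → IsHilbertTransformOf (hilb φ) φ := fun φ hφ => by
    filter_upwards [hφ.diniAt hp] with θ h using h.tendsto_hilbertTrunc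
  refine ⟨⟨fun φ hφ => ⟨hilb φ, hex φ hφ⟩,
    ⟨_, hpos K hK0, hfin K, fun φ ψ hφ hψ => ?_⟩, fun φ ψ χ hφ hψ hχ => ⟨0, ?_⟩⟩,
    fun φ hφ => hφ.memAnalyticBesov_szego hp,
    ⟨_, hpos A hA0, hfin A, fun φ hφ => rpow_one_div_le_of_le_ofReal_mul hp0 (hA φ hφ)⟩,
    fun φ ψ hφ hψ => (hψ.hasNTLimAt_szego hp hφ).ae_hausdorffMeasure,
    fun f γ hf hγ _ => ⟨0, ?_⟩⟩
  · obtain ⟨hψB, hle⟩ := hK φ ψ hφ hψ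
    refine ⟨hψB, rpow_one_div_le_of_le_ofReal_mul hp0 hle,
      rpow_one_div_le_of_le_ofReal_mul hp0 ?_⟩
    have hχ := hex ψ hψB
    rw [← besovEnergy_congr p (hψ.circleAE_hilbert_hilbert hp hφ hχ)]
    exact (hK ψ _ hψB hχ).2
  · filter_upwards [hψ.circleAE_hilbert_hilbert hp hφ hχ] with θ h
    rw [h, add_zero]
  · have hrad := hγ.circleAE_radialLim
    filter_upwards [hγ] with ζ hζ
    rw [add_zero]
    exact hζ.congr fun z hz => (szego_boundary hp hf hrad hz).symm

end WPPaper
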